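/- (Bläser) There do not exist linear functionals f_j, g_j : ℝ^{3×3} → ℝ and matrices H_j ∈ ℝ^{3×3} for j = 1, …, 18 such that for all 3×3 real matrices A and B: A·B = Σ_{j=1}^{18} f_j(A) g_j(B) H_j. Hence the 3×3 matrix multiplication tensor M₃ has rank at least 19. -/

import Mathlib

open Matrix

/-- Real `3 × 3` matrices. -/
abbrev Mat₃ := Matrix (Fin 3) (Fin 3) ℝ

/-- The functional `A ↦ tr (X A)` attached to a matrix `X`. -/
noncomputable def traceFunctional (X : Mat₃) : Mat₃ →ₗ[ℝ] ℝ :=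
  (traceLinearMap (Fin 3) ℝ ℝ).comp (LinearMap.mulLeft ℝ X)

@[simp]
theorem traceFunctional_apply (X A : Mat₃) : traceFunctional X A = trace (X * A) := rfl

/-- A rank-18 decomposition of the trilinear form `tr (A B C)`. -/
def IsTrilinearDecomposition (F G H : Fin 18 → Mat₃) : Prop :=
  ∀ A B C : Mat₃, trace (A * B * C) =
    ∑ j, trace (F j * A) * trace (G j * B) * trace (H j * C)

section LinearAlgebra

variable {V : Type*} [AddCommGroup V] [Module ℝ V] [FiniteDimensional ℝ V] {ι : Type*}

theorem exists_finset_card_eq_finrank_separating [DecidableEq ι] (φ : ι → V →ₗ[ℝ] ℝ) :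
    ∀ (n : ℕ) (U : Submodule ℝ V) (S : Finset ι), Module.finrank ℝ U = n →
      (∀ x ∈ U, (∀ j ∈ S, φ j x = 0) → x = 0) →
      ∃ J ⊆ S, J.card = n ∧ ∀ x ∈ U, (∀ j ∈ J, φ j x = 0) → x = 0 := by
  intro n
  induction n with
  | zero =>
    intro U S hU _
    refine ⟨∅, by simp, rfl, fun x hx _ => ?_⟩
    have := Submodule.finrank_eq_zero.1 hU
    subst this
    simpa using hx
  | succ n ih =>
    intro U S hU hsep
    obtain ⟨x, hx, hx0⟩ : ∃ x ∈ U, x ≠ 0 := by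
      apply Submodule.exists_mem_ne_zero_of_ne_bot
      rintro rfl
      simp at hU
    obtain ⟨j, hj, hjx⟩ : ∃ j ∈ S, φ j x ≠ 0 := by
      by_contra! h
      exact hx0 (hsep x hx h)
    have hfin : Module.finrank ℝ (U ⊓ LinearMap.ker (φ j) : Submodule ℝ V) = n := by
      have h1 := LinearMap.finrank_range_add_finrank_ker ((φ j).domRestrict U)
      have h2 : LinearMap.range ((φ j).domRestrict U) = ⊤ := by
        apply LinearMap.range_eq_top.2
        intro c
        refine ⟨(c / φ j x) • ⟨x, hx⟩, ?_⟩
        simp [LinearMap.domRestrict_apply, hjx]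
      have h3 : Module.finrank ℝ (LinearMap.ker ((φ j).domRestrict U)) =
          Module.finrank ℝ (U ⊓ LinearMap.ker (φ j) : Submodule ℝ V) := by
        rw [← Submodule.map_comap_subtype, Submodule.finrank_map_subtype_eq]
        rfl
      rw [h2, finrank_top, Module.finrank_self] at h1
      omega
    obtain ⟨J, hJS, hJc, hJ⟩ := ih (U ⊓ LinearMap.ker (φ j)) (S.erase j) hfin (by
      rintro y ⟨hy, hyk⟩ h
      refine hsep y hy fun i hi => ?_
      by_cases hij : i = j
      · subst hij; exact hyk
      · exact h i (Finset.mem_erase.2 ⟨hij, hi⟩))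
    have hjJ : j ∉ J := fun h => by simpa using hJS h
    refine ⟨insert j J, ?_, by rw [Finset.card_insert_of_notMem hjJ, hJc], ?_⟩
    · exact Finset.insert_subset hj (hJS.trans (Finset.erase_subset _ _))
    · intro y hy h
      exact hJ y ⟨hy, h j (by simp)⟩ fun i hi => h i (by simp [hi])

theorem exists_mem_forall_eq (φ : ι → V →ₗ[ℝ] ℝ) (U : Submodule ℝ V) (J : Finset ι)
    (hc : J.card = Module.finrank ℝ U)
    (hsep : ∀ x ∈ U, (∀ j ∈ J, φ j x = 0) → x = 0) (c : ι → ℝ) :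
    ∃ x ∈ U, ∀ j ∈ J, φ j x = c j := by
  let L : U →ₗ[ℝ] (J → ℝ) := LinearMap.pi fun j => (φ j).comp U.subtype
  have hinj : Function.Injective L := by
    rw [← LinearMap.ker_eq_bot, LinearMap.ker_eq_bot']
    intro x hx
    apply Subtype.ext
    exact hsep x x.2 fun j hj => congr_fun hx ⟨j, hj⟩
  have hsurj : Function.Surjective L :=
    (LinearMap.injective_iff_surjective_of_finrank_eq_finrank (by simp [hc])).1 hinj
  obtain ⟨x, hx⟩ := hsurj fun j => c j
  exact ⟨x, x.2, fun j hj => congr_fun hx ⟨j, hj⟩⟩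

theorem exists_add_mem_forall_eq_zero (φ : ι → V →ₗ[ℝ] ℝ) (U : Submodule ℝ V) (J : Finset ι)
    (hc : J.card = Module.finrank ℝ U)
    (hsep : ∀ x ∈ U, (∀ j ∈ J, φ j x = 0) → x = 0) (A : V) :
    ∃ A₀ ∈ U, ∀ j ∈ J, φ j (A + A₀) = 0 := by
  obtain ⟨x, hx, h⟩ := exists_mem_forall_eq φ U J hc hsep fun j => -φ j A
  exact ⟨x, hx, fun j hj => by rw [map_add, h j hj, add_neg_cancel]⟩

theorem exists_mem_ne_zero_forall_eq_zero (φ : ι → V →ₗ[ℝ] ℝ) (U : Submodule ℝ V) (S : Finset ι)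
    (hc : S.card < Module.finrank ℝ U) : ∃ x ∈ U, x ≠ 0 ∧ ∀ j ∈ S, φ j x = 0 := by
  let L : U →ₗ[ℝ] (S → ℝ) := LinearMap.pi fun j => (φ j).comp U.subtype
  have h := LinearMap.ker_ne_bot_of_finrank_lt (f := L) (by simpa using hc)
  obtain ⟨x, hx, hx0⟩ := Submodule.exists_mem_ne_zero_of_ne_bot h
  refine ⟨x, x.2, by simpa using hx0, fun j hj => congr_fun (LinearMap.mem_ker.1 hx) ⟨j, hj⟩⟩

theorem exists_ne_zero_forall_eq_zero (φ : ι → V →ₗ[ℝ] ℝ) (S : Finset ι)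
    (hc : S.card < Module.finrank ℝ V) : ∃ x, x ≠ 0 ∧ ∀ j ∈ S, φ j x = 0 := by
  obtain ⟨x, -, h⟩ := exists_mem_ne_zero_forall_eq_zero φ ⊤ S (by simpa using hc)
  exact ⟨x, h⟩

theorem finrank_le_finrank_of_forall_mem {V' : Type*} [AddCommGroup V'] [Module ℝ V']
    (L : V' →ₗ[ℝ] V) (hL : Function.Injective L) (W : Submodule ℝ V) (h : ∀ x, L x ∈ W) :
    Module.finrank ℝ V' ≤ Module.finrank ℝ W :=
  LinearMap.finrank_le_finrank_of_injective (f := L.codRestrict W h)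
    fun _ _ hxy => hL (congrArg Subtype.val hxy)

theorem three_le_finrank_of_vecMulVec_mem {m : ℕ} {p : Fin m → ℝ} (hp : p ≠ 0)
    (W : Submodule ℝ (Matrix (Fin m) (Fin 3) ℝ)) (h : ∀ y, vecMulVec p y ∈ W) :
    3 ≤ Module.finrank ℝ W := by
  have := finrank_le_finrank_of_forall_mem (vecMulVecBilin ℝ ℝ p) (fun x y hxy => by
    obtain ⟨i, hi⟩ := Function.ne_iff.1 hp
    ext j
    have := congr_fun (congr_fun hxy i) j
    simpa [vecMulVecBilin, vecMulVec_apply, show _ ≠ (0 : ℝ) from hi] using this) W h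
  simpa using this

theorem le_finrank_of_vecMulVec_mem {m : ℕ} {y : Fin 3 → ℝ} (hy : y ≠ 0)
    (W : Submodule ℝ (Matrix (Fin m) (Fin 3) ℝ)) (h : ∀ p, vecMulVec p y ∈ W) :
    m ≤ Module.finrank ℝ W := by
  have := finrank_le_finrank_of_forall_mem ((vecMulVecBilin ℝ ℝ).flip y) (fun p q hpq => by
    obtain ⟨i, hi⟩ := Function.ne_iff.1 hy
    ext j
    have := congr_fun (congr_fun hpq j) i
    simpa [vecMulVecBilin, vecMulVec_apply, show _ ≠ (0 : ℝ) from hi] using this) W h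
  simpa using this

/-- Rank-nullity, as a lower bound for the dimension of a kernel. -/
theorem finrank_le_finrank_ker_add {V' : Type*} [AddCommGroup V'] [Module ℝ V']
    [FiniteDimensional ℝ V'] (L : V →ₗ[ℝ] V') :
    Module.finrank ℝ V ≤ Module.finrank ℝ (LinearMap.ker L) + Module.finrank ℝ V' := by
  have h1 := LinearMap.finrank_range_add_finrank_ker L
  have h2 := Submodule.finrank_le (LinearMap.range L)
  omega

end LinearAlgebra

/-- The span of the matrices `H i`, `i ∈ I`. -/
def spanOn (H : Fin 18 → Mat₃) (I : Finset (Fin 18)) : Submodule ℝ Mat₃ :=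
  Submodule.span ℝ (H '' I)

theorem mem_spanOn (H : Fin 18 → Mat₃) {I : Finset (Fin 18)} {i : Fin 18} (hi : i ∈ I) :
    H i ∈ spanOn H I :=
  Submodule.subset_span ⟨i, hi, rfl⟩

theorem spanOn_le {H : Fin 18 → Mat₃} {I : Finset (Fin 18)} {W : Submodule ℝ Mat₃}
    (h : ∀ i ∈ I, H i ∈ W) : spanOn H I ≤ W := by
  rw [spanOn, Submodule.span_le]
  rintro _ ⟨i, hi, rfl⟩
  exact h i hi

theorem spanOn_mono (H : Fin 18 → Mat₃) {I J : Finset (Fin 18)} (h : I ⊆ J) :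
    spanOn H I ≤ spanOn H J :=
  spanOn_le fun _ hi => mem_spanOn H (h hi)

theorem finrank_spanOn_le (H : Fin 18 → Mat₃) (I : Finset (Fin 18)) :
    Module.finrank ℝ (spanOn H I) ≤ I.card := by
  classical
  rw [spanOn, ← Finset.coe_image]
  exact (finrank_span_finset_le_card _).trans Finset.card_image_le

theorem mem_spanOn_iff {H : Fin 18 → Mat₃} {I : Finset (Fin 18)} {X : Mat₃} :
    X ∈ spanOn H I ↔ ∃ c : Fin 18 → ℝ, X = ∑ i ∈ I, c i • H i := by
  constructor
  · intro h
    rw [spanOn] at h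
    obtain ⟨c, hc⟩ := (Submodule.mem_span_image_finset_iff_exists_fun ℝ).1 h
    refine ⟨fun i => if hi : i ∈ I then c ⟨i, hi⟩ else 0, ?_⟩
    rw [← hc, ← Finset.sum_coe_sort I]
    exact Finset.sum_congr rfl fun i _ => by simp
  · rintro ⟨c, rfl⟩
    exact Submodule.sum_mem _ fun i hi => Submodule.smul_mem _ _ (mem_spanOn H hi)

namespace IsTrilinearDecomposition

variable {F G H : Fin 18 → Mat₃}

theorem cyc (h : IsTrilinearDecomposition F G H) : IsTrilinearDecomposition G H F := by
  intro A B C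
  rw [trace_mul_cycle, h C A B]
  exact Finset.sum_congr rfl fun j _ => by ring

theorem transpose (h : IsTrilinearDecomposition F G H) :
    IsTrilinearDecomposition (fun j => (H j)ᵀ) (fun j => (G j)ᵀ) (fun j => (F j)ᵀ) := by
  intro A B C
  have key : ∀ X Y : Mat₃, trace (Xᵀ * Y) = trace (X * Yᵀ) := fun X Y => by
    rw [← trace_transpose, transpose_mul, transpose_transpose, trace_mul_comm]
  have := h Cᵀ Bᵀ Aᵀ
  rw [← transpose_mul, ← transpose_mul, trace_transpose, ← Matrix.mul_assoc] at this
  rw [this]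
  exact Finset.sum_congr rfl fun j _ => by rw [key, key, key]; ring

theorem sandwich (h : IsTrilinearDecomposition F G H) {X Y : Mat₃} (hXY : X * Y = 1) :
    IsTrilinearDecomposition (fun j => F j * X) G (fun j => Y * H j) := by
  intro A B C
  have e : trace (A * B * C) = trace (X * A * B * (C * Y)) := by
    have hYX : Y * X = 1 := mul_eq_one_comm.1 hXY
    rw [← trace_mul_comm (C * Y), Matrix.mul_assoc C, ← Matrix.mul_assoc Y, ← Matrix.mul_assoc Y,
      hYX, Matrix.one_mul, trace_mul_comm]
  rw [e, h]
  refine Finset.sum_congr rfl fun j _ => ?_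
  rw [Matrix.mul_assoc (F j), trace_mul_comm (H j), trace_mul_comm (Y * H j),
    Matrix.mul_assoc C]

theorem mul_eq_sum (h : IsTrilinearDecomposition F G H) (A B : Mat₃) :
    A * B = ∑ j, (trace (F j * A) * trace (G j * B)) • H j := by
  rw [ext_iff_trace_mul_right]
  intro C
  rw [h A B C, Finset.sum_mul, trace_sum]
  exact Finset.sum_congr rfl fun j _ => by rw [smul_mul, trace_smul, smul_eq_mul]

theorem mul_mem_spanOn (h : IsTrilinearDecomposition F G H) {I : Finset (Fin 18)} {A B : Mat₃}
    (hI : ∀ j, j ∉ I → trace (F j * A) = 0 ∨ trace (G j * B) = 0) : A * B ∈ spanOn H I := by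
  rw [h.mul_eq_sum]
  refine Submodule.sum_mem _ fun j _ => ?_
  by_cases hj : j ∈ I
  · exact Submodule.smul_mem _ _ (mem_spanOn H hj)
  · have : trace (F j * A) * trace (G j * B) = 0 := by
      rcases hI j hj with h0 | h0 <;> simp [h0]
    rw [this, zero_smul]
    exact Submodule.zero_mem _

theorem spanOn_univ (h : IsTrilinearDecomposition F G H) : spanOn H Finset.univ = ⊤ := by
  rw [eq_top_iff]
  intro X _
  rw [← Matrix.one_mul X]
  exact h.mul_mem_spanOn (by simp)

theorem eq_zero_of_trace (h : IsTrilinearDecomposition F G H) {A : Mat₃}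
    (hA : ∀ j, trace (F j * A) = 0) : A = 0 := by
  have := h.mul_eq_sum A 1
  simpa [hA] using this

end IsTrilinearDecomposition

/-- `P` is a surjection `ℝ³ → ℝ²` with kernel spanned by `s`. -/
structure IsProjectionAlong (P : Matrix (Fin 2) (Fin 3) ℝ) (s : Fin 3 → ℝ) : Prop where
  mulVec_eq_zero : P *ᵥ s = 0
  exists_inverse : ∃ (R : Matrix (Fin 3) (Fin 2) ℝ) (q : Fin 3 → ℝ),
    P * R = 1 ∧ R * P + vecMulVec s q = 1

theorem exists_isProjectionAlong {s : Fin 3 → ℝ} (hs : s ≠ 0) :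
    ∃ P, IsProjectionAlong P s := by
  obtain ⟨i, hi⟩ := Function.ne_iff.1 hs
  have hi : s i ≠ 0 := hi
  fin_cases i
  · refine ⟨!![-s 1 / s 0, 1, 0; -s 2 / s 0, 0, 1], ?_, !![0, 0; 1, 0; 0, 1], ![1 / s 0, 0, 0],
      ?_, ?_⟩
    · ext k; fin_cases k <;> simp [mulVec, dotProduct, Fin.sum_univ_three] at hi ⊢ <;> grind
    · ext k l; fin_cases k <;> fin_cases l <;> simp
    · ext k l; fin_cases k <;> fin_cases l <;>
        simp at hi ⊢ <;> grind
  · refine ⟨!![1, -s 0 / s 1, 0; 0, -s 2 / s 1, 1], ?_, !![1, 0; 0, 0; 0, 1], ![0, 1 / s 1, 0],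
      ?_, ?_⟩
    · ext k; fin_cases k <;> simp [mulVec, dotProduct, Fin.sum_univ_three] at hi ⊢ <;> grind
    · ext k l; fin_cases k <;> fin_cases l <;> simp
    · ext k l; fin_cases k <;> fin_cases l <;>
        simp at hi ⊢ <;> grind
  · refine ⟨!![1, 0, -s 0 / s 2; 0, 1, -s 1 / s 2], ?_, !![1, 0; 0, 1; 0, 0], ![0, 0, 1 / s 2],
      ?_, ?_⟩
    · ext k; fin_cases k <;> simp [mulVec, dotProduct, Fin.sum_univ_three] at hi ⊢ <;> grind
    · ext k l; fin_cases k <;> fin_cases l <;> simp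
    · ext k l; fin_cases k <;> fin_cases l <;>
        simp at hi ⊢ <;> grind

namespace IsProjectionAlong

variable {P : Matrix (Fin 2) (Fin 3) ℝ} {s : Fin 3 → ℝ}

theorem exists_eq_vecMulVec (hP : IsProjectionAlong P s) {X : Mat₃} (hX : P * X = 0) :
    ∃ x, X = vecMulVec s x := by
  obtain ⟨R, q, -, h⟩ := hP.exists_inverse
  refine ⟨q ᵥ* X, ?_⟩
  calc X = (R * P + vecMulVec s q) * X := by rw [h, Matrix.one_mul]
    _ = _ := by rw [Matrix.add_mul, Matrix.mul_assoc, hX, Matrix.mul_zero, zero_add,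
      vecMulVec_mul]

theorem exists_eq_smul (hP : IsProjectionAlong P s) {w : Fin 3 → ℝ} (hw : P *ᵥ w = 0) :
    ∃ c : ℝ, w = c • s := by
  obtain ⟨R, q, -, h⟩ := hP.exists_inverse
  refine ⟨q ⬝ᵥ w, ?_⟩
  calc w = (R * P + vecMulVec s q) *ᵥ w := by rw [h, Matrix.one_mulVec]
    _ = _ := by
      rw [Matrix.add_mulVec, ← Matrix.mulVec_mulVec, hw, Matrix.mulVec_zero, zero_add,
        vecMulVec_mulVec]
      simp

theorem exists_mulVec_eq (hP : IsProjectionAlong P s) (e : Fin 2 → ℝ) : ∃ w, P *ᵥ w = e := by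
  obtain ⟨R, q, h, -⟩ := hP.exists_inverse
  exact ⟨R *ᵥ e, by rw [Matrix.mulVec_mulVec, h, Matrix.one_mulVec]⟩

theorem mul_vecMulVec (hP : IsProjectionAlong P s) (x : Fin 3 → ℝ) : P * vecMulVec s x = 0 := by
  rw [Matrix.mul_vecMulVec, hP.mulVec_eq_zero, zero_vecMulVec]

end IsProjectionAlong

theorem dotProduct_self_ne_zero {n : ℕ} {v : Fin n → ℝ} (hv : v ≠ 0) : v ⬝ᵥ v ≠ 0 :=
  fun h => hv (dotProduct_self_eq_zero.1 h)

theorem exists_dotProduct_eq_one {n : ℕ} {v : Fin n → ℝ} (hv : v ≠ 0) : ∃ w, v ⬝ᵥ w = 1 :=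
  ⟨(v ⬝ᵥ v)⁻¹ • v, by simp [dotProduct_self_ne_zero hv]⟩

theorem six_le_finrank_ker_mulVec (v : Fin 3 → ℝ) :
    6 ≤ Module.finrank ℝ (LinearMap.ker ((mulVecBilin ℝ ℝ).flip v : Mat₃ →ₗ[ℝ] Fin 3 → ℝ)) := by
  have := finrank_le_finrank_ker_add ((mulVecBilin ℝ ℝ).flip v : Mat₃ →ₗ[ℝ] Fin 3 → ℝ)
  simp [Module.finrank_matrix] at this
  omega

theorem six_le_finrank_ker_vecMul (v : Fin 3 → ℝ) :
    6 ≤ Module.finrank ℝ (LinearMap.ker (vecMulBilin ℝ ℝ v : Mat₃ →ₗ[ℝ] Fin 3 → ℝ)) := by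
  have := finrank_le_finrank_ker_add (vecMulBilin ℝ ℝ v : Mat₃ →ₗ[ℝ] Fin 3 → ℝ)
  simp [Module.finrank_matrix] at this
  omega

namespace IsTrilinearDecomposition

variable {F G H : Fin 18 → Mat₃} {I : Finset (Fin 18)}
  {P : Matrix (Fin 2) (Fin 3) ℝ} {s : Fin 3 → ℝ}

theorem eq_zero_of_forall_mul_mem (h : IsTrilinearDecomposition F G H) {U : Submodule ℝ Mat₃}
    (hsep : ∀ A ∈ U, (∀ B, A * B ∈ spanOn H I) → A = 0) :
    ∀ A ∈ U, (∀ j ∈ Iᶜ, traceFunctional (F j) A = 0) → A = 0 :=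
  fun A hA hz => hsep A hA fun _ => h.mul_mem_spanOn fun j hj =>
    Or.inl (hz j (Finset.mem_compl.2 hj))

theorem exists_ne_zero_forall_mul_mem (h : IsTrilinearDecomposition F G H) (U : Submodule ℝ Mat₃)
    (hc : 10 ≤ I.card + Module.finrank ℝ U)
    (hsep : ∀ A ∈ U, (∀ B, A * B ∈ spanOn H I) → A = 0) :
    ∃ B, B ≠ 0 ∧ ∀ A, ∃ A₀ ∈ U, (A + A₀) * B ∈ spanOn H I := by
  obtain ⟨J, hJI, hJc, hJ⟩ := exists_finset_card_eq_finrank_separating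
    (fun j => traceFunctional (F j)) _ U Iᶜ rfl (h.eq_zero_of_forall_mul_mem hsep)
  have hdis : Disjoint I J := by
    rw [Finset.disjoint_left]
    exact fun i hi hj => Finset.mem_compl.1 (hJI hj) hi
  obtain ⟨B, hB0, hB⟩ := exists_ne_zero_forall_eq_zero (fun j => traceFunctional (G j)) (I ∪ J)ᶜ (by
    rw [Finset.card_compl, Finset.card_union_of_disjoint hdis, Module.finrank_matrix]
    simp
    omega)
  refine ⟨B, hB0, fun A => ?_⟩
  obtain ⟨A₀, hA₀, hA⟩ := exists_add_mem_forall_eq_zero _ U J hJc hJ A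
  refine ⟨A₀, hA₀, h.mul_mem_spanOn fun j hj => ?_⟩
  by_cases hjJ : j ∈ J
  · exact Or.inl (hA j hjJ)
  · exact Or.inr (hB j (by simp [hj, hjJ]))

/-- No four matrices `H i` whose images under `P` have a common kernel vector can be in general
position with respect to `P`. -/
theorem false_of_common_kernel (h : IsTrilinearDecomposition F G H) (hI : I.card = 4)
    (hP : IsProjectionAlong P s) (hs : ∃ x, vecMulVec s x ∉ spanOn H I)
    (hy : ∀ y ≠ 0, ∃ e, vecMulVec e y ∉ (spanOn H I).map (mulLeftLinearMap (Fin 3) ℝ P))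
    {v : Fin 3 → ℝ} (hv : v ≠ 0) (hkill : ∀ X ∈ spanOn H I, (P * X) *ᵥ v = 0) : False := by
  let U : Submodule ℝ Mat₃ := LinearMap.ker (mulLeftLinearMap (Fin 3) ℝ P)
  let V : Submodule ℝ Mat₃ := LinearMap.ker ((mulVecBilin ℝ ℝ).flip v : Mat₃ →ₗ[ℝ] Fin 3 → ℝ)
  have memU : ∀ A : Mat₃, A ∈ U ↔ P * A = 0 := fun A => Iff.rfl
  have memV : ∀ B : Mat₃, B ∈ V ↔ B *ᵥ v = 0 := fun B => Iff.rfl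
  obtain ⟨x₀, hx₀⟩ := hs
  obtain ⟨JA, hJAI, hJAc, hJA⟩ := exists_finset_card_eq_finrank_separating
    (fun j => traceFunctional (F j)) _ U Iᶜ rfl (h.eq_zero_of_forall_mul_mem (by
      intro A hA hAB
      by_contra hA0
      obtain ⟨a, rfl⟩ := hP.exists_eq_vecMulVec ((memU A).1 hA)
      have ha : a ≠ 0 := by rintro rfl; simp at hA0
      obtain ⟨w, hw⟩ := exists_dotProduct_eq_one ha
      apply hx₀
      have := hAB (vecMulVec w x₀)
      rwa [vecMulVec_mul_vecMulVec, hw, one_smul] at this))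
  have hlift := exists_add_mem_forall_eq_zero _ U JA hJAc hJA
  obtain ⟨JB, hJBI, hJBc, hJB⟩ := exists_finset_card_eq_finrank_separating
    (fun j => traceFunctional (G j)) _ V (I ∪ JA)ᶜ rfl (by
      intro B hB hz
      by_contra hB0
      obtain ⟨i, hi⟩ := Function.ne_iff.1 hB0
      obtain ⟨e, he⟩ := hy (B i) hi
      obtain ⟨w, rfl⟩ := hP.exists_mulVec_eq e
      obtain ⟨A₀, hA₀, hA⟩ := hlift (vecMulVec w (Pi.single i 1))
      apply he
      refine ⟨(vecMulVec w (Pi.single i 1) + A₀) * B, h.mul_mem_spanOn fun j hj => ?_, ?_⟩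
      · by_cases hjJ : j ∈ JA
        · exact Or.inl (hA j hjJ)
        · exact Or.inr (hz j (by simp [hj, hjJ]))
      · rw [mulLeftLinearMap_apply, ← Matrix.mul_assoc, Matrix.mul_add, (memU _).1 hA₀, add_zero,
          Matrix.mul_vecMulVec, vecMulVec_mul, single_one_vecMul]
        rfl)
  have hliftB := exists_add_mem_forall_eq_zero _ V JB hJBc hJB
  have hdis : Disjoint I JB := by
    rw [Finset.disjoint_left]
    exact fun i hi hj => Finset.mem_compl.1 (hJBI hj) (Finset.mem_union_left _ hi)
  obtain ⟨A, hA0, hA⟩ := exists_ne_zero_forall_eq_zero (fun j => traceFunctional (F j)) (I ∪ JB)ᶜ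
    (by
      have : 6 ≤ Module.finrank ℝ V := six_le_finrank_ker_mulVec v
      rw [Finset.card_compl, Finset.card_union_of_disjoint hdis, Module.finrank_matrix]
      simp
      omega)
  obtain ⟨w, hw⟩ := exists_dotProduct_eq_one hv
  have hPA : P * A = 0 := by
    ext i k
    obtain ⟨B₁, hB₁, hB⟩ := hliftB (vecMulVec (Pi.single k 1) w)
    have hmem : A * (vecMulVec (Pi.single k 1) w + B₁) ∈ spanOn H I := by
      refine h.mul_mem_spanOn fun j hj => ?_
      by_cases hjJ : j ∈ JB
      · exact Or.inr (hB j hjJ)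
      · exact Or.inl (hA j (by simp [hj, hjJ]))
    have := hkill _ hmem
    rw [← Matrix.mul_assoc, ← Matrix.mulVec_mulVec, Matrix.add_mulVec, (memV _).1 hB₁, add_zero,
      vecMulVec_mulVec, dotProduct_comm, hw] at this
    simpa using congr_fun this i
  refine hA0 (hJA A hPA fun j hj => hA j ?_)
  rw [Finset.mem_compl, Finset.mem_union]
  rintro (h1 | h1)
  · exact Finset.mem_compl.1 (hJAI hj) h1
  · exact Finset.mem_compl.1 (hJBI h1) (Finset.mem_union_right _ hj)

end IsTrilinearDecomposition

section LinearAlgebra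

variable {V : Type*} [AddCommGroup V] [Module ℝ V] [FiniteDimensional ℝ V]

theorem exists_eq_smul_of_finrank_le_one {W : Submodule ℝ V} (hW : Module.finrank ℝ W ≤ 1)
    {x y : V} (hx : x ∈ W) (hx0 : x ≠ 0) (hy : y ∈ W) : ∃ c : ℝ, y = c • x := by
  obtain ⟨v, hv⟩ := finrank_le_one_iff.1 hW
  obtain ⟨a, ha⟩ := hv ⟨x, hx⟩
  obtain ⟨b, hb⟩ := hv ⟨y, hy⟩
  have ha' : a • (v : V) = x := congrArg Subtype.val ha
  have hb' : b • (v : V) = y := congrArg Subtype.val hb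
  have ha0 : a ≠ 0 := by
    rintro rfl
    simp at ha'
    exact hx0 ha'.symm
  refine ⟨b / a, ?_⟩
  rw [← ha', ← hb', smul_smul, div_mul_cancel₀ _ ha0]

theorem finrank_inf_lt {W K : Submodule ℝ V} {x : V} (hx : x ∈ W) (hxK : x ∉ K) :
    Module.finrank ℝ (W ⊓ K : Submodule ℝ V) < Module.finrank ℝ W :=
  Submodule.finrank_lt_finrank_of_lt (inf_le_left.lt_of_ne fun h => hxK (by
    rw [← h] at hx
    exact hx.2))

end LinearAlgebra

theorem vecMulVec_eq_zero_iff_real {m n : ℕ} {x : Fin m → ℝ} {y : Fin n → ℝ} :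
    vecMulVec x y = 0 ↔ x = 0 ∨ y = 0 := by
  constructor
  · intro h
    by_contra! hne
    obtain ⟨i, hi⟩ := Function.ne_iff.1 hne.1
    obtain ⟨j, hj⟩ := Function.ne_iff.1 hne.2
    exact mul_ne_zero hi hj (congr_fun (congr_fun h i) j)
  · rintro (rfl | rfl) <;> ext <;> simp [vecMulVec_apply]

/-- A nonzero `u` orthogonal to the column of some nonzero rank-one matrix in `D`, provided that
`D` contains any nonzero rank-one matrix. -/
theorem exists_covector_of_rankOne (D : Submodule ℝ (Matrix (Fin 2) (Fin 3) ℝ)) :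
    ∃ u : Fin 2 → ℝ, u ≠ 0 ∧ ∀ e b, e ≠ 0 → b ≠ 0 → vecMulVec e b ∈ D →
      ∃ e₀ b₀, vecMulVec e₀ b₀ ≠ 0 ∧ u ⬝ᵥ e₀ = 0 ∧ vecMulVec e₀ b₀ ∈ D := by
  by_cases hr : ∃ e b, e ≠ 0 ∧ b ≠ 0 ∧ vecMulVec e b ∈ D
  · obtain ⟨e, b, he, hb, hmem⟩ := hr
    refine ⟨![-e 1, e 0], fun h => he ?_, fun _ _ _ _ _ => ⟨e, b, ?_, ?_, hmem⟩⟩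
    · have h0 := congr_fun h 0
      have h1 := congr_fun h 1
      simp at h0 h1
      ext i; fin_cases i <;> simp [h0, h1]
    · simp [vecMulVec_eq_zero_iff_real, he, hb]
    · simp [dotProduct, Fin.sum_univ_two]
      ring
  · push Not at hr
    exact ⟨![1, 0], fun h => by simpa using congr_fun h 0,
      fun e b he hb h => (hr e b he hb h).elim⟩

namespace IsProjectionAlong

variable {P : Matrix (Fin 2) (Fin 3) ℝ} {s : Fin 3 → ℝ}

theorem vecMul_ne_zero (hP : IsProjectionAlong P s) {u : Fin 2 → ℝ} (hu : u ≠ 0) :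
    u ᵥ* P ≠ 0 := by
  intro h
  obtain ⟨w, hw⟩ := exists_dotProduct_eq_one hu
  obtain ⟨z, rfl⟩ := hP.exists_mulVec_eq w
  rw [dotProduct_mulVec, h, zero_dotProduct] at hw
  exact zero_ne_one hw

theorem finrank_map_add_three_le (hP : IsProjectionAlong P s) (hs : s ≠ 0)
    {D : Submodule ℝ Mat₃} (h : ∀ x, vecMulVec s x ∈ D) :
    Module.finrank ℝ (D.map (mulLeftLinearMap (Fin 3) ℝ P)) + 3 ≤ Module.finrank ℝ D := by
  have h1 := LinearMap.finrank_range_add_finrank_ker ((mulLeftLinearMap (Fin 3) ℝ P).domRestrict D)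
  rw [LinearMap.range_domRestrict] at h1
  have h2 := finrank_le_finrank_of_forall_mem
    ((vecMulVecBilin ℝ ℝ s).codRestrict D h : (Fin 3 → ℝ) →ₗ[ℝ] D) (by
      intro x y hxy
      have h3 : vecMulVec s (x - y) = 0 := by
        rw [vecMulVec_sub, sub_eq_zero]
        exact congrArg Subtype.val hxy
      rcases vecMulVec_eq_zero_iff_real.1 h3 with h4 | h4
      · exact (hs h4).elim
      · exact sub_eq_zero.1 h4)
    (LinearMap.ker ((mulLeftLinearMap (Fin 3) ℝ P).domRestrict D)) hP.mul_vecMulVec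
  rw [Module.finrank_fin_fun] at h2
  exact (Nat.add_le_add_left h2 _).trans h1.le

end IsProjectionAlong

namespace IsTrilinearDecomposition

variable {F G H : Fin 18 → Mat₃} {I : Finset (Fin 18)}
  {P : Matrix (Fin 2) (Fin 3) ℝ} {s : Fin 3 → ℝ}

theorem false_of_no_common_kernel (h : IsTrilinearDecomposition F G H) (hI : I.card = 4)
    (hP : IsProjectionAlong P s)
    (hD : Module.finrank ℝ ((spanOn H I).map (mulLeftLinearMap (Fin 3) ℝ P)) ≤ 2)
    (hs : ∃ x, vecMulVec s x ∉ spanOn H I)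
    (hker : ∀ v ≠ 0, ∃ X ∈ spanOn H I, (P * X) *ᵥ v ≠ 0) : False := by
  set D := (spanOn H I).map (mulLeftLinearMap (Fin 3) ℝ P) with hDdef
  have memD : ∀ X ∈ spanOn H I, P * X ∈ D := fun X hX => ⟨X, hX, rfl⟩
  obtain ⟨u, hu, hrank⟩ := exists_covector_of_rankOne D
  obtain ⟨x₀, hx₀⟩ := hs
  let U : Submodule ℝ Mat₃ := LinearMap.ker (vecMulBilin ℝ ℝ (u ᵥ* P) : Mat₃ →ₗ[ℝ] Fin 3 → ℝ)
  have hU : 6 ≤ Module.finrank ℝ U := six_le_finrank_ker_vecMul _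
  obtain ⟨B, hB0, hB⟩ := h.exists_ne_zero_forall_mul_mem (I := I) U (by omega) (by
    intro A _ hAB
    by_contra hA0
    obtain ⟨b, hb⟩ : ∃ b, A *ᵥ b ≠ 0 := by
      by_contra! hz
      exact hA0 (Matrix.ext_of_mulVec_single fun i => by rw [hz, zero_mulVec])
    have hmem : ∀ y, vecMulVec (A *ᵥ b) y ∈ spanOn H I := fun y => by
      rw [← Matrix.mul_vecMulVec]
      exact hAB _
    by_cases hPb : P *ᵥ (A *ᵥ b) = 0
    · obtain ⟨c, hc⟩ := hP.exists_eq_smul hPb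
      have hc0 : c ≠ 0 := by
        rintro rfl
        exact hb (by simp [hc])
      have := (spanOn H I).smul_mem c⁻¹ (hmem x₀)
      rw [hc, smul_vecMulVec, smul_smul, inv_mul_cancel₀ hc0, one_smul] at this
      exact hx₀ this
    · have := three_le_finrank_of_vecMulVec_mem hPb D fun y => by
        rw [← Matrix.mul_vecMulVec]
        exact memD _ (hmem y)
      omega)
  obtain ⟨w, hw⟩ := exists_dotProduct_eq_one (hP.vecMul_ne_zero hu)
  have hrow : ∀ r : Fin 3 → ℝ, ∃ A', A' * B ∈ spanOn H I ∧ u ᵥ* (P * (A' * B)) = r ᵥ* B := by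
    intro r
    obtain ⟨A₀, hA₀, hA⟩ := hB (vecMulVec w r)
    refine ⟨_, hA, ?_⟩
    have hA₀' : (u ᵥ* P) ᵥ* A₀ = 0 := hA₀
    rw [← Matrix.vecMul_vecMul, ← Matrix.vecMul_vecMul, vecMul_add, hA₀', add_zero,
      vecMul_vecMulVec, hw, one_smul]
  have hdet : B.det = 0 := by
    by_contra hdet
    have hle : (⊤ : Submodule ℝ (Fin 3 → ℝ)) ≤ D.map (vecMulBilin ℝ ℝ u) := by
      intro c _
      obtain ⟨A', hA', he⟩ := hrow (c ᵥ* B⁻¹)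
      refine ⟨_, memD _ hA', ?_⟩
      rw [vecMulBilin_apply, he, vecMul_vecMul, nonsing_inv_mul _ (Ne.isUnit hdet), vecMul_one]
    have h1 := Submodule.finrank_mono hle
    have h2 := Submodule.finrank_map_le (vecMulBilin ℝ ℝ u :
      Matrix (Fin 2) (Fin 3) ℝ →ₗ[ℝ] Fin 3 → ℝ) D
    simp at h1
    omega
  obtain ⟨v, hv, hBv⟩ := exists_mulVec_eq_zero_iff.2 hdet
  have hkerle : ∀ v ≠ 0, Module.finrank ℝ (D ⊓ LinearMap.ker ((mulVecBilin ℝ ℝ).flip v) :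
      Submodule ℝ (Matrix (Fin 2) (Fin 3) ℝ)) ≤ 1 := by
    intro v hv
    obtain ⟨X, hX, hXv⟩ := hker v hv
    have := finrank_inf_lt (K := LinearMap.ker ((mulVecBilin ℝ ℝ).flip v)) (memD X hX) hXv
    omega
  obtain ⟨i, hi⟩ := Function.ne_iff.1 hB0
  obtain ⟨A', hA', he⟩ := hrow (Pi.single i 1)
  rw [single_one_vecMul] at he
  have hkill : ∀ A, (P * (A * B)) *ᵥ v = 0 := fun A => by
    rw [← Matrix.mulVec_mulVec, ← Matrix.mulVec_mulVec, hBv, mulVec_zero, mulVec_zero]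
  set x := P * (A' * B) with hx
  have hx0 : x ≠ 0 := by
    intro h0
    rw [h0, vecMul_zero] at he
    exact hi he.symm
  have hmul : ∀ r, ∃ c : ℝ, r ᵥ* B = c • B i := by
    intro r
    obtain ⟨A'', hA'', he'⟩ := hrow r
    obtain ⟨c, hc⟩ := exists_eq_smul_of_finrank_le_one (hkerle v hv)
      ⟨memD _ hA', hkill A'⟩ hx0 ⟨memD _ hA'', hkill A''⟩
    refine ⟨c, ?_⟩
    rw [← he', hc, vecMul_smul, ← hx, he]
    rfl
  choose c hc using fun k => hmul ((P * A') k)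
  have hxe : x = vecMulVec c (B i) := by
    ext k l
    rw [hx, ← Matrix.mul_assoc, vecMulVec_apply]
    exact congr_fun (hc k) l
  have huc : u ⬝ᵥ c = 1 := by
    rw [hxe, vecMul_vecMulVec] at he
    have h1 : (u ⬝ᵥ c - 1) • B i = 0 := by rw [sub_smul, one_smul, he]; exact sub_self _
    rcases smul_eq_zero.1 h1 with h2 | h2
    · linarith
    · exact (hi h2).elim
  obtain ⟨e₀, b₀, hne, hue, hmem⟩ := hrank c (B i) (by rintro rfl; simp at huc) hi
    (hxe ▸ memD _ hA')
  obtain ⟨v', hv', hvb⟩ := exists_ne_zero_forall_eq_zero (V := Fin 3 → ℝ) (ι := Fin 2)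
    (fun k => dotProductBilin ℝ ℝ (![b₀, B i] k)) Finset.univ (by simp)
  have hvb0 : b₀ ⬝ᵥ v' = 0 := hvb 0 (by simp)
  have hvb1 : B i ⬝ᵥ v' = 0 := hvb 1 (by simp)
  obtain ⟨t, ht⟩ := exists_eq_smul_of_finrank_le_one (hkerle v' hv')
    (x := vecMulVec c (B i)) (y := vecMulVec e₀ b₀)
    ⟨hxe ▸ memD _ hA', by simp [vecMulVec_mulVec, hvb1]⟩ (hxe ▸ hx0)
    ⟨hmem, by simp [vecMulVec_mulVec, hvb0]⟩
  have h1 := congrArg (u ᵥ* ·) ht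
  simp only [vecMul_smul, vecMul_vecMulVec, hue, huc, zero_smul, one_smul] at h1
  rcases smul_eq_zero.1 h1.symm with h2 | h2
  · exact hne (by rw [ht, h2, zero_smul])
  · exact hi h2

theorem false_of_finrank_map_le_two (h : IsTrilinearDecomposition F G H) (hI : I.card = 4)
    (hP : IsProjectionAlong P s)
    (hD : Module.finrank ℝ ((spanOn H I).map (mulLeftLinearMap (Fin 3) ℝ P)) ≤ 2)
    (hs : ∃ x, vecMulVec s x ∉ spanOn H I)
    (hy : ∀ y ≠ 0, ∃ e, vecMulVec e y ∉ (spanOn H I).map (mulLeftLinearMap (Fin 3) ℝ P)) :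
    False := by
  by_cases hker : ∀ v ≠ 0, ∃ X ∈ spanOn H I, (P * X) *ᵥ v ≠ 0
  · exact h.false_of_no_common_kernel hI hP hD hs hker
  · push Not at hker
    obtain ⟨v, hv, hkill⟩ := hker
    exact h.false_of_common_kernel hI hP hs hy hv hkill

end IsTrilinearDecomposition

theorem finrank_span_singleton_le {V : Type*} [AddCommGroup V] [Module ℝ V] (x : V) :
    Module.finrank ℝ (Submodule.span ℝ {x}) ≤ 1 := by
  simpa using finrank_span_le_card (R := ℝ) ({x} : Set V)

namespace IsTrilinearDecomposition

variable {F G H : Fin 18 → Mat₃} {I : Finset (Fin 18)}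
  {P : Matrix (Fin 2) (Fin 3) ℝ} {s : Fin 3 → ℝ}

/-- The matrices `P * H j` span all `2 × 3` matrices. -/
theorem exists_mul_notMem (h : IsTrilinearDecomposition F G H) (hP : IsProjectionAlong P s)
    (W : Submodule ℝ (Matrix (Fin 2) (Fin 3) ℝ)) (hW : Module.finrank ℝ W ≤ 5) :
    ∃ c, P * H c ∉ W := by
  by_contra! hc
  obtain ⟨R, q, hPR, -⟩ := hP.exists_inverse
  have hle : spanOn H Finset.univ ≤ W.comap (mulLeftLinearMap (Fin 3) ℝ P) :=
    spanOn_le fun i _ => hc i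
  rw [h.spanOn_univ] at hle
  have htop : W = ⊤ := by
    rw [eq_top_iff]
    intro Z _
    have h1 : P * (R * Z) ∈ W := hle (Submodule.mem_top (x := R * Z))
    rwa [← Matrix.mul_assoc, hPR, Matrix.one_mul] at h1
  rw [htop, finrank_top, Module.finrank_matrix] at hW
  simp at hW

theorem false_of_finrank_map_le_one (h : IsTrilinearDecomposition F G H) (hI : I.card = 3)
    (hP : IsProjectionAlong P s)
    (hD : Module.finrank ℝ ((spanOn H I).map (mulLeftLinearMap (Fin 3) ℝ P)) ≤ 1)
    (hs : ∃ x, vecMulVec s x ∉ spanOn H I) : False := by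
  set L : Mat₃ →ₗ[ℝ] Matrix (Fin 2) (Fin 3) ℝ := mulLeftLinearMap (Fin 3) ℝ P with hL
  set D := (spanOn H I).map L with hDdef
  obtain ⟨y, hy⟩ : ∃ y : Fin 3 → ℝ, D ≠ ⊥ → y ≠ 0 ∧ ∃ d ∈ D, ∃ i, d i = y := by
    by_cases hbot : D = ⊥
    · exact ⟨0, fun h => (h hbot).elim⟩
    · obtain ⟨d, hd, hd0⟩ := Submodule.exists_mem_ne_zero_of_ne_bot hbot
      obtain ⟨i, hi⟩ := Function.ne_iff.1 hd0
      exact ⟨d i, fun _ => ⟨hi, d, hd, i, rfl⟩⟩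
  have hR : ∀ y : Fin 3 → ℝ, Module.finrank ℝ
      (LinearMap.range ((vecMulVecBilin ℝ ℝ : (Fin 2 → ℝ) →ₗ[ℝ] _).flip y)) ≤ 2 := fun y => by
    simpa using LinearMap.finrank_range_le ((vecMulVecBilin ℝ ℝ : (Fin 2 → ℝ) →ₗ[ℝ] _).flip y)
  obtain ⟨c, hc⟩ := h.exists_mul_notMem hP
    (D ⊔ LinearMap.range ((vecMulVecBilin ℝ ℝ : (Fin 2 → ℝ) →ₗ[ℝ] _).flip y)) (by
      have h1 := Submodule.finrank_add_le_finrank_add_finrank D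
        (LinearMap.range ((vecMulVecBilin ℝ ℝ : (Fin 2 → ℝ) →ₗ[ℝ] _).flip y))
      have h2 := hR y
      omega)
  have hcD : P * H c ∉ D := fun h' => hc (Submodule.mem_sup_left h')
  have hcI : c ∉ I := fun hcI => hcD ⟨H c, mem_spanOn H hcI, rfl⟩
  have hins : spanOn H (insert c I) = spanOn H I ⊔ Submodule.span ℝ {H c} := by
    rw [spanOn, spanOn, Finset.coe_insert, Set.image_insert_eq, Submodule.span_insert, sup_comm]
  have hmap : (spanOn H (insert c I)).map L = D ⊔ Submodule.span ℝ {P * H c} := by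
    rw [hins, Submodule.map_sup, Submodule.map_span, Set.image_singleton]
    rfl
  have h1span : Module.finrank ℝ (Submodule.span ℝ {P * H c}) ≤ 1 :=
    finrank_span_singleton_le _
  have hfin := Submodule.finrank_add_le_finrank_add_finrank D (Submodule.span ℝ {P * H c})
  refine h.false_of_finrank_map_le_two (I := insert c I) (by
    rw [Finset.card_insert_of_notMem hcI, hI]) hP ?_ ?_ ?_
  · rw [← hL, hmap]
    omega
  · obtain ⟨x, hx⟩ := hs
    refine ⟨x, fun hmem => hx ?_⟩
    rw [hins, Submodule.mem_sup] at hmem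
    obtain ⟨z, hz, z', hz', hsum⟩ := hmem
    obtain ⟨a, rfl⟩ := Submodule.mem_span_singleton.1 hz'
    have h0 : P * z + a • (P * H c) = 0 := by
      rw [← Matrix.mul_smul, ← Matrix.mul_add, hsum, hP.mul_vecMulVec]
    have ha : a = 0 := by
      by_contra ha
      apply hcD
      have : P * H c = (-a⁻¹) • (P * z) := by
        rw [eq_neg_of_add_eq_zero_left h0, smul_neg, neg_smul, neg_neg, smul_smul,
          inv_mul_cancel₀ ha, one_smul]
      rw [this]
      exact D.smul_mem _ ⟨z, hz, rfl⟩
    rw [ha, zero_smul, add_zero] at hsum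
    rwa [← hsum]
  · intro y' hy'
    by_contra! hall
    rw [← hL, hmap] at hall
    have h2 := le_finrank_of_vecMulVec_mem hy' _ hall
    have heq : LinearMap.range ((vecMulVecBilin ℝ ℝ : (Fin 2 → ℝ) →ₗ[ℝ] _).flip y') =
        D ⊔ Submodule.span ℝ {P * H c} := by
      apply Submodule.eq_of_le_of_finrank_le
      · rintro _ ⟨e, rfl⟩
        exact hall e
      · have h3 := le_finrank_of_vecMulVec_mem hy' (LinearMap.range
          ((vecMulVecBilin ℝ ℝ : (Fin 2 → ℝ) →ₗ[ℝ] _).flip y')) fun e => ⟨e, rfl⟩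
        omega
    have hbot : D ≠ ⊥ := by
      intro hbot
      rw [hbot, finrank_bot] at hfin
      rw [hbot] at h2
      omega
    obtain ⟨hy0, d, hd, i, hi⟩ := hy hbot
    obtain ⟨e', he'⟩ : d ∈ LinearMap.range
        ((vecMulVecBilin ℝ ℝ : (Fin 2 → ℝ) →ₗ[ℝ] _).flip y') := by
      rw [heq]
      exact Submodule.mem_sup_left hd
    obtain ⟨e, he⟩ : P * H c ∈ LinearMap.range
        ((vecMulVecBilin ℝ ℝ : (Fin 2 → ℝ) →ₗ[ℝ] _).flip y') := by
      rw [heq]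
      exact Submodule.mem_sup_right (Submodule.mem_span_singleton_self _)
    have hyy : y = e' i • y' := by
      rw [← hi, ← he']
      rfl
    have he0 : e' i ≠ 0 := by
      intro h0
      rw [h0, zero_smul] at hyy
      exact hy0 hyy
    apply hc
    refine Submodule.mem_sup_right ⟨(e' i)⁻¹ • e, ?_⟩
    change vecMulVec ((e' i)⁻¹ • e) y = _
    rw [hyy, smul_vecMulVec, vecMulVec_smul, smul_smul, inv_mul_cancel₀ he0, one_smul]
    exact he

/-- Two of the `H j` cannot have all columns in the same line. -/
theorem false_of_two_in_line (h : IsTrilinearDecomposition F G H) (hP : IsProjectionAlong P s)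
    (hs : s ≠ 0) {a b : Fin 18} (hab : a ≠ b) (ha : P * H a = 0) (hb : P * H b = 0) : False := by
  obtain ⟨i, hi⟩ := h.exists_mul_notMem hP ⊥ (by simp)
  have hi0 : P * H i ≠ 0 := hi
  have hai : a ≠ i := by rintro rfl; exact hi0 ha
  have hbi : b ≠ i := by rintro rfl; exact hi0 hb
  have hcard : ({a, b, i} : Finset (Fin 18)).card = 3 := Finset.card_eq_three.2
    ⟨a, b, i, hab, hai, hbi, rfl⟩
  have hle : (spanOn H {a, b, i}).map (mulLeftLinearMap (Fin 3) ℝ P) ≤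
      Submodule.span ℝ {P * H i} := by
    rw [Submodule.map_le_iff_le_comap]
    refine spanOn_le fun j hj => ?_
    simp only [Finset.mem_insert, Finset.mem_singleton] at hj
    rw [Submodule.mem_comap, mulLeftLinearMap_apply]
    rcases hj with rfl | rfl | rfl
    · rw [ha]; exact Submodule.zero_mem _
    · rw [hb]; exact Submodule.zero_mem _
    · exact Submodule.mem_span_singleton_self _
  refine h.false_of_finrank_map_le_one hcard hP
    ((Submodule.finrank_mono hle).trans (finrank_span_singleton_le _)) ?_
  by_contra! hall
  have h1 := hP.finrank_map_add_three_le hs hall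
  have h2 := finrank_spanOn_le H {a, b, i}
  have h3 := Submodule.finrank_eq_zero.1 (show Module.finrank ℝ
    ((spanOn H {a, b, i}).map (mulLeftLinearMap (Fin 3) ℝ P)) = 0 by omega)
  apply hi0
  have h4 : P * H i ∈ (spanOn H {a, b, i}).map (mulLeftLinearMap (Fin 3) ℝ P) :=
    ⟨H i, mem_spanOn H (by simp), rfl⟩
  rw [h3] at h4
  exact h4

/-- Four of the `H j` cannot have a common left kernel vector. -/
theorem false_of_four_vecMul_eq_zero (h : IsTrilinearDecomposition F G H) (hI : I.card = 4)
    {u : Fin 3 → ℝ} (hu : u ≠ 0) (hker : ∀ i ∈ I, u ᵥ* H i = 0) : False := by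
  have hspan : ∀ X ∈ spanOn H I, u ᵥ* X = 0 := fun X hX =>
    (spanOn_le (W := LinearMap.ker (vecMulBilin ℝ ℝ u : Mat₃ →ₗ[ℝ] Fin 3 → ℝ)) hker) hX
  let U : Submodule ℝ Mat₃ := LinearMap.ker (vecMulBilin ℝ ℝ u : Mat₃ →ₗ[ℝ] Fin 3 → ℝ)
  have hU : 6 ≤ Module.finrank ℝ U := six_le_finrank_ker_vecMul _
  obtain ⟨B, hB0, hB⟩ := h.exists_ne_zero_forall_mul_mem (I := I) U (by omega) (by
    intro A _ hAB
    by_contra hA0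
    obtain ⟨b, hb⟩ : ∃ b, A *ᵥ b ≠ 0 := by
      by_contra! hz
      exact hA0 (Matrix.ext_of_mulVec_single fun i => by rw [hz, zero_mulVec])
    obtain ⟨P, hP⟩ := exists_isProjectionAlong hb
    have hmem : ∀ y, vecMulVec (A *ᵥ b) y ∈ spanOn H I := fun y => by
      rw [← Matrix.mul_vecMulVec]
      exact hAB _
    have h1 := hP.finrank_map_add_three_le hb hmem
    have h2 := finrank_spanOn_le H I
    by_cases hne : ∃ i ∈ I, P * H i ≠ 0
    · obtain ⟨i, hi, hi0⟩ := hne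
      obtain ⟨I', hiI', hI'I, hcard⟩ := Finset.exists_subsuperset_card_eq
        (Finset.singleton_subset_iff.2 hi) (n := 3) (by simp) (by omega)
      rw [Finset.singleton_subset_iff] at hiI'
      have hle := Submodule.finrank_mono (Submodule.map_mono (f := mulLeftLinearMap (Fin 3) ℝ P)
        (spanOn_mono H hI'I))
      refine h.false_of_finrank_map_le_one hcard hP (by omega) ?_
      by_contra! hall
      have h3 := hP.finrank_map_add_three_le hb hall
      have h4 := finrank_spanOn_le H I'
      have h5 := Submodule.finrank_eq_zero.1 (show Module.finrank ℝ
        ((spanOn H I').map (mulLeftLinearMap (Fin 3) ℝ P)) = 0 by omega)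
      have h6 : P * H i ∈ (spanOn H I').map (mulLeftLinearMap (Fin 3) ℝ P) :=
        ⟨H i, mem_spanOn H hiI', rfl⟩
      rw [h5] at h6
      exact hi0 h6
    · push Not at hne
      obtain ⟨a, ha, b, hb', hab⟩ := Finset.one_lt_card.1 (show 1 < I.card by omega)
      exact h.false_of_two_in_line hP hb hab (hne a ha) (hne b hb'))
  obtain ⟨w, hw⟩ := exists_dotProduct_eq_one hu
  apply hB0
  ext i k
  obtain ⟨A₀, hA₀, hA⟩ := hB (vecMulVec w (Pi.single i 1))
  have h1 := hspan _ hA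
  have hA₀' : u ᵥ* A₀ = 0 := hA₀
  rw [← Matrix.vecMul_vecMul, vecMul_add, hA₀', add_zero, vecMul_vecMulVec, hw, one_smul,
    single_one_vecMul] at h1
  exact congr_fun h1 k

end IsTrilinearDecomposition

namespace IsTrilinearDecomposition

variable {F G H : Fin 18 → Mat₃} {I : Finset (Fin 18)}

theorem transpose_cyc (h : IsTrilinearDecomposition F G H) :
    IsTrilinearDecomposition (fun j => (G j)ᵀ) (fun j => (F j)ᵀ) (fun j => (H j)ᵀ) :=
  h.transpose.cyc

theorem false_of_four_mulVec_eq_zero (h : IsTrilinearDecomposition F G H) (hI : I.card = 4)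
    {v : Fin 3 → ℝ} (hv : v ≠ 0) (hker : ∀ i ∈ I, H i *ᵥ v = 0) : False :=
  h.transpose_cyc.false_of_four_vecMul_eq_zero hI hv fun i hi => by
    rw [vecMul_transpose, hker i hi]

theorem false_of_two_same_column (h : IsTrilinearDecomposition F G H) {s : Fin 3 → ℝ}
    (hs : s ≠ 0) {a b : Fin 18} (hab : a ≠ b) {x y : Fin 3 → ℝ} (ha : H a = vecMulVec s x)
    (hb : H b = vecMulVec s y) : False := by
  obtain ⟨P, hP⟩ := exists_isProjectionAlong hs
  exact h.false_of_two_in_line hP hs hab (by rw [ha, hP.mul_vecMulVec])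
    (by rw [hb, hP.mul_vecMulVec])

theorem false_of_two_same_row (h : IsTrilinearDecomposition F G H) {s : Fin 3 → ℝ}
    (hs : s ≠ 0) {a b : Fin 18} (hab : a ≠ b) {x y : Fin 3 → ℝ} (ha : H a = vecMulVec x s)
    (hb : H b = vecMulVec y s) : False :=
  h.transpose_cyc.false_of_two_same_column hs hab (by rw [ha, transpose_vecMulVec])
    (by rw [hb, transpose_vecMulVec])

/-- The matrices `H j`, `j ∈ I`, are independent if their span has full dimension. -/
theorem _root_.eq_zero_of_sum_smul_eq_zero {H : Fin 18 → Mat₃} {I : Finset (Fin 18)}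
    (hI : I.card ≤ Module.finrank ℝ (spanOn H I)) {c : Fin 18 → ℝ}
    (hc : ∑ i ∈ I, c i • H i = 0) : ∀ i ∈ I, c i = 0 := by
  have hrange : Set.range (fun i : I => H i) = H '' I := by
    ext X
    simp
  have hli : LinearIndependent ℝ (fun i : I => H i) := by
    rw [linearIndependent_iff_card_eq_finrank_span, Set.finrank, hrange]
    have := finrank_spanOn_le H I
    rw [Fintype.card_coe]
    exact le_antisymm hI this
  intro i hi
  exact Fintype.linearIndependent_iff.1 hli (fun i => c i)
    (by rw [← hc, ← Finset.sum_coe_sort I]) ⟨i, hi⟩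

/-- Every nonzero matrix is detected by at least five of the functionals `F j`. -/
theorem five_le_card_filter (h : IsTrilinearDecomposition F G H) {Z : Mat₃} (hZ : Z ≠ 0) :
    5 ≤ (Finset.univ.filter fun j => trace (F j * Z) ≠ 0).card := by
  by_contra! hcard
  set S := Finset.univ.filter fun j => trace (F j * Z) ≠ 0 with hS
  have hZS : ∀ B, Z * B ∈ spanOn H S := fun B => h.mul_mem_spanOn fun j hj => by
    left
    simpa [hS] using hj
  obtain ⟨b, hb⟩ : ∃ b, Z *ᵥ b ≠ 0 := by
    by_contra! hz
    exact hZ (Matrix.ext_of_mulVec_single fun i => by rw [hz, zero_mulVec])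
  obtain ⟨P, hP⟩ := exists_isProjectionAlong hb
  have h1 := hP.finrank_map_add_three_le hb (D := spanOn H S) fun y => by
    rw [← Matrix.mul_vecMulVec]
    exact hZS _
  have h2 := finrank_spanOn_le H S
  have hPZ : P * Z = 0 := by
    by_contra hne
    obtain ⟨b', hb'⟩ : ∃ b, (P * Z) *ᵥ b ≠ 0 := by
      by_contra! hz
      exact hne (Matrix.ext_of_mulVec_single fun i => by rw [hz, zero_mulVec])
    have h3 := three_le_finrank_of_vecMulVec_mem hb'
      ((spanOn H S).map (mulLeftLinearMap (Fin 3) ℝ P)) fun y =>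
        ⟨Z * vecMulVec b' y, hZS _, by
          rw [mulLeftLinearMap_apply, ← Matrix.mul_assoc, Matrix.mul_vecMulVec]⟩
    omega
  obtain ⟨a, ha⟩ := hP.exists_eq_vecMulVec hPZ
  by_cases hfin : Module.finrank ℝ (spanOn H S) ≤ 3
  · have h3 := Submodule.finrank_eq_zero.1 (show Module.finrank ℝ
      ((spanOn H S).map (mulLeftLinearMap (Fin 3) ℝ P)) = 0 by omega)
    have hzero : ∀ i ∈ S, P * H i = 0 := by
      intro i hi
      have h4 : P * H i ∈ (spanOn H S).map (mulLeftLinearMap (Fin 3) ℝ P) :=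
        ⟨H i, mem_spanOn H hi, rfl⟩
      rw [h3] at h4
      exact h4
    obtain ⟨i, hi, j, hj, hij⟩ := Finset.one_lt_card.1 (show 1 < S.card by omega)
    exact h.false_of_two_in_line hP hb hij (hzero i hi) (hzero j hj)
  · obtain ⟨κ, hκ, hκa⟩ := exists_ne_zero_forall_eq_zero (V := Fin 3 → ℝ) (ι := Fin 1)
      (fun _ => dotProductBilin ℝ ℝ a) Finset.univ (by simp)
    have haκ : a ⬝ᵥ κ = 0 := hκa 0 (by simp)
    refine h.cyc.cyc.false_of_four_mulVec_eq_zero (I := S) (by omega) hκ fun j hj => ?_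
    refine dotProduct_eq_zero _ fun y => ?_
    have hZB : Z * vecMulVec κ y = 0 := by
      rw [ha, vecMulVec_mul_vecMulVec, haκ, zero_smul, vecMulVec_zero]
    have hsum : ∑ j ∈ S, (trace (F j * Z) * trace (G j * vecMulVec κ y)) • H j = 0 := by
      rw [← hZB, h.mul_eq_sum Z]
      refine Finset.sum_subset (Finset.subset_univ _) fun j _ hj => ?_
      have : trace (F j * Z) = 0 := by simpa [hS] using hj
      rw [this, zero_mul, zero_smul]
    have h5 := eq_zero_of_sum_smul_eq_zero (by omega) hsum j hj
    have h6 : trace (F j * Z) ≠ 0 := by simpa [hS] using hj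
    have h7 := (mul_eq_zero.1 h5).resolve_left h6
    rwa [Matrix.mul_vecMulVec, trace_vecMulVec] at h7

end IsTrilinearDecomposition

/-- The common kernel of the functionals `A ↦ tr (F j * A)`, `j ∈ J`. -/
noncomputable def commonKernel (F : Fin 18 → Mat₃) (J : Finset (Fin 18)) : Submodule ℝ Mat₃ :=
  LinearMap.ker (LinearMap.pi fun j : J => traceFunctional (F j))

theorem mem_commonKernel {F : Fin 18 → Mat₃} {J : Finset (Fin 18)} {A : Mat₃} :
    A ∈ commonKernel F J ↔ ∀ j ∈ J, trace (F j * A) = 0 := by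
  rw [commonKernel, LinearMap.mem_ker, funext_iff]
  exact ⟨fun h j hj => h ⟨j, hj⟩, fun h j => h j j.2⟩

theorem nine_le_finrank_commonKernel_add (F : Fin 18 → Mat₃) (J : Finset (Fin 18)) :
    9 ≤ Module.finrank ℝ (commonKernel F J) + J.card := by
  have h1 := finrank_le_finrank_ker_add (LinearMap.pi fun j : J => traceFunctional (F j))
  rw [Module.finrank_matrix, Module.finrank_fintype_fun_eq_card, Fintype.card_coe] at h1
  simp only [Fintype.card_fin, Module.finrank_self] at h1
  exact h1

/-- The functionals `F l`, `l ∈ E`, are seven coordinates, with dual vectors `X l`, whose common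
kernel is the span of the identity and a nonzero traceless matrix `Y`. -/
structure IsCoordinatePencil (F : Fin 18 → Mat₃) (E : Finset (Fin 18)) (Y : Mat₃)
    (X : Fin 18 → Mat₃) : Prop where
  card_eq : E.card = 7
  trace_eq_zero : ∀ l ∈ E, trace (F l) = 0
  ne_zero : Y ≠ 0
  trace_right : trace Y = 0
  trace_mul : ∀ l ∈ E, trace (F l * Y) = 0
  dual : ∀ l ∈ E, ∀ m ∈ E, trace (F m * X l) = if m = l then 1 else 0

theorem exists_dual_of_finrank_le_two {F : Fin 18 → Mat₃} {J : Finset (Fin 18)}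
    (hJ : Module.finrank ℝ (commonKernel F J) ≤ 2) :
    ∃ E ⊆ J, E.card = 7 ∧ ∃ X : Fin 18 → Mat₃,
      ∀ l ∈ E, ∀ m ∈ E, trace (F m * X l) = if m = l then 1 else 0 := by
  obtain ⟨U, hU⟩ := Submodule.exists_isCompl (commonKernel F J)
  have hfin := Submodule.finrank_add_eq_of_isCompl hU
  have h9 : Module.finrank ℝ Mat₃ = 9 := by simp [Module.finrank_matrix]
  obtain ⟨J', hJ'J, hJ'c, hJ'⟩ := exists_finset_card_eq_finrank_separating
    (fun j => traceFunctional (F j)) _ U J rfl (by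
      intro x hx hz
      have : x ∈ commonKernel F J ⊓ U := ⟨mem_commonKernel.2 hz, hx⟩
      rwa [hU.inf_eq_bot, Submodule.mem_bot] at this)
  obtain ⟨E, hEJ', hE⟩ := Finset.exists_subset_card_eq (show 7 ≤ J'.card by omega)
  choose X _ hX using fun l : Fin 18 =>
    exists_mem_forall_eq _ U J' hJ'c hJ' fun m => if m = l then 1 else 0
  exact ⟨E, hEJ'.trans hJ'J, hE, X, fun l _ m hm => hX l m (hEJ' hm)⟩

/-- Finitely many functionals take a common generic vector to values that are equal only when
forced. -/
theorem exists_mem_forall_eq_imp {V : Type*} [AddCommGroup V] [Module ℝ V] {ι : Type*} [Finite ι]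
    (φ : ι → V →ₗ[ℝ] ℝ) (K : Submodule ℝ V) :
    ∃ y ∈ K, ∀ i j, φ i y = φ j y → ∀ x ∈ K, φ i x = φ j x := by
  let T := {p : ι × ι // ∃ x ∈ K, (φ p.1 - φ p.2) x ≠ 0}
  obtain ⟨y, hy, h⟩ := Module.Dual.exists_forall_mem_ne_zero_of_forall_exists K
    (fun p : T => φ p.1.1 - φ p.1.2) fun p => p.2
  refine ⟨y, hy, fun i j hij => ?_⟩
  by_contra! hne
  obtain ⟨x, hx, hxne⟩ := hne
  exact h ⟨(i, j), x, hx, by simpa [sub_eq_zero] using hxne⟩ (by simp [hij])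

theorem card_le_three_of_det_sub_eq_zero {X Y : Mat₃} (hX : X.det ≠ 0) (T : Finset ℝ)
    (hT : ∀ t ∈ T, (Y - t • X).det = 0) : T.card ≤ 3 := by
  have hdeg : (X⁻¹ * Y).charpoly.natDegree = 3 := by
    rw [charpoly_natDegree_eq_dim, Fintype.card_fin]
  have hne : (X⁻¹ * Y).charpoly ≠ 0 := (Matrix.charpoly_monic (X⁻¹ * Y)).ne_zero
  have hroot : ∀ t ∈ T, (X⁻¹ * Y).charpoly.eval t = 0 := by
    intro t ht
    have h1 : scalar (Fin 3) t - X⁻¹ * Y = -(X⁻¹ * (Y - t • X)) := by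
      rw [Matrix.mul_sub, Matrix.mul_smul, nonsing_inv_mul _ (Ne.isUnit hX), neg_sub,
        smul_one_eq_diagonal]
      rfl
    rw [Matrix.eval_charpoly, h1, det_neg, det_mul, hT t ht, mul_zero, mul_zero]
  rw [← hdeg]
  exact Polynomial.card_le_degree_of_subset_roots fun t ht =>
    (Polynomial.mem_roots hne).2 (hroot t ht)

namespace IsTrilinearDecomposition

variable {F G H : Fin 18 → Mat₃}

theorem finrank_commonKernel_le_two (h : IsTrilinearDecomposition F G H) {J : Finset (Fin 18)}
    {X : Mat₃} (hX : X.det ≠ 0) (hXJ : X ∈ commonKernel F J)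
    (hmax : ∀ j ∉ J, ∀ A ∈ commonKernel F J, trace (F j * A) = 0 → A.det = 0) :
    Module.finrank ℝ (commonKernel F J) ≤ 2 := by
  by_contra! hk
  set K := commonKernel F J with hKdef
  have hX0 : ∀ j ∉ J, trace (F j * X) ≠ 0 := fun j hj h0 => hX (hmax j hj X hXJ h0)
  let φ : Fin 18 → Mat₃ →ₗ[ℝ] ℝ := fun j => (trace (F j * X))⁻¹ • traceFunctional (F j)
  have hφ : ∀ j A, φ j A = (trace (F j * X))⁻¹ * trace (F j * A) := fun j A => rfl
  have hφ0 : ∀ j ∉ J, ∀ A, φ j A = 0 ↔ trace (F j * A) = 0 := fun j hj A => by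
    rw [hφ, mul_eq_zero, or_iff_right (inv_ne_zero (hX0 j hj))]
  have hsep : ∀ A ∈ K, (∀ j ∉ J, φ j A = 0) → A = 0 := by
    intro A hA hz
    refine h.eq_zero_of_trace fun j => ?_
    by_cases hj : j ∈ J
    · exact mem_commonKernel.1 hA j hj
    · exact (hφ0 j hj A).1 (hz j hj)
  obtain ⟨Y, hY, hgen⟩ := exists_mem_forall_eq_imp φ K
  set T : Finset ℝ := Jᶜ.image fun j => φ j Y with hT
  have hT3 : T.card ≤ 3 := by
    refine card_le_three_of_det_sub_eq_zero (Y := Y) hX T fun t ht => ?_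
    obtain ⟨j, hj, rfl⟩ := Finset.mem_image.1 ht
    rw [Finset.mem_compl] at hj
    refine hmax j hj _ (K.sub_mem hY (K.smul_mem _ hXJ)) ?_
    rw [Matrix.mul_sub, trace_sub, Matrix.mul_smul, trace_smul, hφ, smul_eq_mul]
    field_simp [hX0 j hj]
    ring
  have hrep : ∀ t : ℝ, ∃ j, t ∈ T → j ∉ J ∧ φ j Y = t := by
    intro t
    by_cases ht : t ∈ T
    · obtain ⟨j, hj, hjt⟩ := Finset.mem_image.1 ht
      exact ⟨j, fun _ => ⟨Finset.mem_compl.1 hj, hjt⟩⟩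
    · exact ⟨0, fun h => (ht h).elim⟩
  choose r hr using hrep
  have hmemT : ∀ j ∉ J, φ j Y ∈ T := fun j hj =>
    Finset.mem_image.2 ⟨j, Finset.mem_compl.2 hj, rfl⟩
  have heq : ∀ j ∉ J, ∀ A ∈ K, φ j A = φ (r (φ j Y)) A := fun j hj A hA =>
    hgen j (r (φ j Y)) (hr _ (hmemT j hj)).2.symm A hA
  have hkT : Module.finrank ℝ K ≤ T.card := by
    by_contra! hlt
    obtain ⟨Z, hZ, hZ0, hz⟩ := exists_mem_ne_zero_forall_eq_zero φ K (T.image r)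
      (Finset.card_image_le.trans_lt hlt)
    exact hZ0 (hsep Z hZ fun j hj => by
      rw [heq j hj Z hZ]
      exact hz _ (Finset.mem_image_of_mem _ (hmemT j hj)))
  have h9 : 9 ≤ Module.finrank ℝ K + J.card := nine_le_finrank_commonKernel_add F J
  have hcompl : Jᶜ.card = 18 - J.card := by simp [Finset.card_compl]
  obtain ⟨t, ht, hfib⟩ := Finset.exists_card_fiber_le_of_card_le_mul (s := Jᶜ) (t := T)
    (f := fun j => φ j Y) (n := 4) (Finset.card_pos.1 (by omega)) (by omega)
  obtain ⟨Z, hZ, hZ0, hz⟩ := exists_mem_ne_zero_forall_eq_zero φ K ((T.erase t).image r)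
    (Finset.card_image_le.trans_lt (by rw [Finset.card_erase_of_mem ht]; omega))
  have h5 := h.five_le_card_filter hZ0
  have hle : (Finset.univ.filter fun j => trace (F j * Z) ≠ 0).card ≤
      (Jᶜ.filter fun j => φ j Y = t).card := by
    refine Finset.card_le_card fun j hj => ?_
    rw [Finset.mem_filter] at hj ⊢
    have hjJ : j ∉ J := fun hjJ => hj.2 (mem_commonKernel.1 hZ j hjJ)
    refine ⟨Finset.mem_compl.2 hjJ, ?_⟩
    by_contra hne
    refine hj.2 ((hφ0 j hjJ Z).1 ?_)
    rw [heq j hjJ Z hZ]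
    exact hz _ (Finset.mem_image_of_mem _ (Finset.mem_erase.2 ⟨hne, hmemT j hjJ⟩))
  omega

theorem exists_isCoordinatePencil (h : IsTrilinearDecomposition F G H) :
    ∃ F' G' H' E Y X, IsTrilinearDecomposition F' G' H' ∧ IsCoordinatePencil F' E Y X := by
  classical
  let 𝒮 : Finset (Finset (Fin 18)) :=
    Finset.univ.filter fun J => ∃ X ∈ commonKernel F J, X.det ≠ 0
  obtain ⟨J, hJ⟩ := 𝒮.exists_maximal ⟨∅, by
    rw [Finset.mem_filter]
    exact ⟨Finset.mem_univ _, 1, mem_commonKernel.2 (by simp), by simp⟩⟩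
  obtain ⟨X, hXJ, hX⟩ := (Finset.mem_filter.1 hJ.1).2
  have hk := h.finrank_commonKernel_le_two hX hXJ (by
    intro j hj A hA hjA
    by_contra hdet
    have hmem : insert j J ∈ 𝒮 := by
      rw [Finset.mem_filter]
      refine ⟨Finset.mem_univ _, A, mem_commonKernel.2 fun i hi => ?_, hdet⟩
      rcases Finset.mem_insert.1 hi with rfl | hi
      · exact hjA
      · exact mem_commonKernel.1 hA i hi
    exact hj (hJ.2 hmem (Finset.subset_insert _ _) (Finset.mem_insert_self _ _)))
  obtain ⟨E, hEJ, hE, D, hD⟩ := exists_dual_of_finrank_le_two hk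
  have hXX : X * X⁻¹ = 1 := mul_nonsing_inv _ (Ne.isUnit hX)
  obtain ⟨Y, hY1, hY0, hY⟩ := exists_mem_ne_zero_forall_eq_zero
    (fun j => traceFunctional (F j * X)) (LinearMap.ker (traceFunctional 1)) E (by
      have h1 := finrank_le_finrank_ker_add (traceFunctional 1)
      rw [Module.finrank_matrix, Module.finrank_self] at h1
      simp only [Fintype.card_fin] at h1
      omega)
  refine ⟨_, _, _, E, Y, fun l => X⁻¹ * D l, h.sandwich hXX, hE,
    fun l hl => mem_commonKernel.1 hXJ l (hEJ hl), hY0, by simpa using hY1, hY, fun l hl m hm => ?_⟩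
  rw [← hD l hl m hm, Matrix.mul_assoc, ← Matrix.mul_assoc X, hXX, Matrix.one_mul]

end IsTrilinearDecomposition

theorem exists_eq_vecMulVec_of_rank_le_one {M : Mat₃} (hM : M.rank ≤ 1) :
    ∃ u v, M = vecMulVec u v := by
  by_cases h0 : M = 0
  · exact ⟨0, 0, by rw [h0, zero_vecMulVec]⟩
  obtain ⟨i, hi⟩ : ∃ i, M.col i ≠ 0 := by
    by_contra! h
    exact h0 (by ext k i; exact congr_fun (h i) k)
  have hmem : ∀ i, M.col i ∈ LinearMap.range M.mulVecLin := fun i =>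
    ⟨Pi.single i 1, by rw [mulVecLin_apply, mulVec_single_one]⟩
  choose c hc using fun k => exists_eq_smul_of_finrank_le_one hM (hmem i) hi (hmem k)
  refine ⟨M.col i, c, ?_⟩
  ext j k
  have := congr_fun (hc k) j
  rw [vecMulVec_apply, mul_comm]
  exact this

theorem exists_eq_smul_of_mulVec_eq_zero {M : Mat₃} (hM : ¬ M.rank ≤ 1) {x y : Fin 3 → ℝ}
    (hx0 : x ≠ 0) (hx : M *ᵥ x = 0) (hy : M *ᵥ y = 0) : ∃ c : ℝ, y = c • x := by
  have h1 := LinearMap.finrank_range_add_finrank_ker M.mulVecLin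
  rw [Module.finrank_fin_fun] at h1
  refine exists_eq_smul_of_finrank_le_one (W := LinearMap.ker M.mulVecLin) ?_ hx hx0 hy
  rw [Matrix.rank] at hM
  omega

theorem exists_eq_smul_of_vecMul_eq_zero {M : Mat₃} (hM : ¬ M.rank ≤ 1) {x y : Fin 3 → ℝ}
    (hx0 : x ≠ 0) (hx : x ᵥ* M = 0) (hy : y ᵥ* M = 0) : ∃ c : ℝ, y = c • x := by
  rw [← rank_transpose] at hM
  rw [← mulVec_transpose] at hx hy
  exact exists_eq_smul_of_mulVec_eq_zero hM hx0 hx hy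

/-- The commutator condition `rank [M, X] ≤ 1` for `M` singular forces `X` to share a right or a
left eigenvector, the same ones for all `X`. -/
theorem exists_common_eigenvectors_of_det_eq_zero {M : Mat₃} (hM0 : M ≠ 0) (hdet : M.det = 0) :
    ∃ w ξ : Fin 3 → ℝ, w ≠ 0 ∧ ξ ≠ 0 ∧ (∃ c : ℝ, M *ᵥ w = c • w) ∧ (∃ c : ℝ, ξ ᵥ* M = c • ξ) ∧
      ∀ X : Mat₃, (M * X - X * M).rank ≤ 1 →
        (∃ c : ℝ, X *ᵥ w = c • w) ∨ (∃ c : ℝ, ξ ᵥ* X = c • ξ) := by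
  by_cases hr : M.rank ≤ 1
  · obtain ⟨u, v, rfl⟩ := exists_eq_vecMulVec_of_rank_le_one hr
    have hu : u ≠ 0 := fun h => hM0 (by rw [h, zero_vecMulVec])
    have hv : v ≠ 0 := fun h => hM0 (by rw [h, vecMulVec_zero])
    have hmul : ∀ x, vecMulVec u v *ᵥ x = (v ⬝ᵥ x) • u := fun x => by
      rw [vecMulVec_mulVec]; simp
    refine ⟨u, v, hu, hv, ⟨v ⬝ᵥ u, hmul u⟩, ⟨v ⬝ᵥ u, by rw [vecMul_vecMulVec]⟩, fun X hX => ?_⟩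
    obtain ⟨p, q, hpq⟩ := exists_eq_vecMulVec_of_rank_le_one hX
    have hC : ∀ b, (v ⬝ᵥ X *ᵥ b) • u - (v ⬝ᵥ b) • X *ᵥ u = (q ⬝ᵥ b) • p := fun b => by
      have := congrArg (fun N => N *ᵥ b) hpq
      simp only [sub_mulVec, ← mulVec_mulVec, hmul, mulVec_smul, vecMulVec_mulVec] at this
      simpa using this
    obtain ⟨b, hb⟩ := exists_dotProduct_eq_one hv
    by_cases hk : ∀ k, v ⬝ᵥ k = 0 → v ⬝ᵥ X *ᵥ k = 0
    · refine Or.inr ⟨v ⬝ᵥ X *ᵥ b, funext fun i => ?_⟩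
      have := hk (Pi.single i 1 - v i • b) (by
        rw [dotProduct_sub, dotProduct_smul, hb, dotProduct_single_one]; simp)
      rw [mulVec_sub, dotProduct_sub, mulVec_smul, dotProduct_smul, dotProduct_mulVec,
        dotProduct_single_one, sub_eq_zero] at this
      rw [this, Pi.smul_apply, smul_eq_mul, smul_eq_mul, mul_comm]
    · push Not at hk
      obtain ⟨k, hk, hk'⟩ := hk
      have h1 := hC k
      rw [hk, zero_smul, sub_zero] at h1
      have hqk : q ⬝ᵥ k ≠ 0 := by
        intro h0
        rw [h0, zero_smul, smul_eq_zero] at h1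
        exact h1.elim hk' hu
      have hp : p = ((q ⬝ᵥ k)⁻¹ * (v ⬝ᵥ X *ᵥ k)) • u := by
        rw [mul_smul, h1, smul_smul, inv_mul_cancel₀ hqk, one_smul]
      have h2 := hC b
      rw [hb, one_smul, hp, smul_smul, sub_eq_iff_eq_add, ← sub_eq_iff_eq_add', ← sub_smul] at h2
      exact Or.inl ⟨_, h2.symm⟩
  · obtain ⟨w, hw0, hw⟩ := exists_mulVec_eq_zero_iff.2 hdet
    obtain ⟨ξ, hξ0, hξ⟩ := exists_vecMul_eq_zero_iff.2 hdet
    refine ⟨w, ξ, hw0, hξ0, ⟨0, by rw [hw, zero_smul]⟩, ⟨0, by rw [hξ, zero_smul]⟩,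
      fun X hX => ?_⟩
    by_cases hXw : M *ᵥ (X *ᵥ w) = 0
    · exact Or.inl (exists_eq_smul_of_mulVec_eq_zero hr hw0 hw hXw)
    · refine Or.inr (exists_eq_smul_of_vecMul_eq_zero hr hξ0 hξ ?_)
      obtain ⟨p, q, hpq⟩ := exists_eq_vecMulVec_of_rank_le_one hX
      have h1 : M *ᵥ (X *ᵥ w) = (q ⬝ᵥ w) • p := by
        have := congrArg (fun N => N *ᵥ w) hpq
        simp only [sub_mulVec, ← mulVec_mulVec, hw, mulVec_zero, sub_zero, vecMulVec_mulVec] at this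
        simpa using this
      have hqw : q ⬝ᵥ w ≠ 0 := fun h0 => hXw (by rw [h1, h0, zero_smul])
      have hξp : ξ ⬝ᵥ p = 0 := by
        have := congrArg (fun x => ξ ⬝ᵥ x) h1
        simp only [dotProduct_mulVec, hξ, zero_dotProduct, zero_vecMul, dotProduct_smul,
          smul_eq_mul] at this
        exact (mul_eq_zero.1 this.symm).resolve_left hqw
      have := congrArg (fun N => ξ ᵥ* N) hpq
      simp only [vecMul_sub, ← vecMul_vecMul, hξ, zero_vecMul, zero_sub, vecMul_vecMulVec, hξp,
        zero_smul, neg_eq_zero] at this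
      exact this

theorem exists_det_smul_one_sub_nonneg (Y : Mat₃) : ∃ t : ℝ, 0 ≤ (t • (1 : Mat₃) - Y).det := by
  have hlim := Polynomial.tendsto_atTop_of_leadingCoeff_nonneg Y.charpoly
    (by rw [charpoly_degree_eq_dim]; norm_num)
    (by rw [(charpoly_monic Y).leadingCoeff]; exact zero_le_one)
  obtain ⟨t, ht⟩ := (hlim.eventually_ge_atTop 0).exists
  refine ⟨t, ?_⟩
  rwa [eval_charpoly, scalar_apply, ← smul_one_eq_diagonal] at ht

theorem exists_det_sub_smul_one_eq_zero (Y : Mat₃) : ∃ t : ℝ, (Y - t • (1 : Mat₃)).det = 0 := by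
  obtain ⟨a, ha⟩ := exists_det_smul_one_sub_nonneg Y
  obtain ⟨b, hb⟩ := exists_det_smul_one_sub_nonneg (-Y)
  have hcont : Continuous fun t : ℝ => (Y - t • (1 : Mat₃)).det := by fun_prop
  refine mem_range_of_exists_le_of_exists_ge hcont ⟨a, ?_⟩ ⟨-b, ?_⟩
  · rw [← neg_sub, det_neg, Fintype.card_fin]
    linarith
  · rwa [neg_smul, sub_neg_eq_add, add_comm, ← sub_neg_eq_add]

theorem trace_vecMulVec_mul (w b : Fin 3 → ℝ) (A : Mat₃) :
    trace (vecMulVec w b * A) = b ⬝ᵥ A *ᵥ w := by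
  rw [trace_mul_comm, mul_vecMulVec, trace_vecMulVec, dotProduct_comm]

namespace IsCoordinatePencil

variable {F : Fin 18 → Mat₃} {E : Finset (Fin 18)} {Y : Mat₃} {X : Fin 18 → Mat₃}

theorem transpose (hE : IsCoordinatePencil F E Y X) :
    IsCoordinatePencil (fun j => (F j)ᵀ) E Yᵀ (fun j => (X j)ᵀ) where
  card_eq := hE.card_eq
  trace_eq_zero l hl := by rw [trace_transpose, hE.trace_eq_zero l hl]
  ne_zero := by simpa using hE.ne_zero
  trace_right := by rw [trace_transpose, hE.trace_right]
  trace_mul l hl := by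
    rw [← transpose_mul, trace_transpose, trace_mul_comm, hE.trace_mul l hl]
  dual l hl m hm := by
    rw [← transpose_mul, trace_transpose, trace_mul_comm, hE.dual l hl m hm]

theorem finrank_commonKernel (hE : IsCoordinatePencil F E Y X) :
    Module.finrank ℝ (commonKernel F E) = 2 := by
  let L := LinearMap.pi fun j : E => traceFunctional (F j)
  have hsurj : LinearMap.range L = ⊤ := by
    refine LinearMap.range_eq_top.2 fun c => ⟨∑ l : E, c l • X l, funext fun m => ?_⟩
    change trace (F m * _) = _
    rw [Finset.mul_sum, trace_sum, Finset.sum_eq_single m]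
    · rw [Matrix.mul_smul, trace_smul, hE.dual m m.2 m m.2, if_pos rfl, smul_eq_mul, mul_one]
    · intro l _ hl
      rw [Matrix.mul_smul, trace_smul, hE.dual l l.2 m m.2, if_neg (fun h => hl (Subtype.ext h.symm)),
        smul_zero]
    · simp
  have h1 := LinearMap.finrank_range_add_finrank_ker L
  rw [hsurj, finrank_top, Module.finrank_fintype_fun_eq_card, Fintype.card_coe, hE.card_eq,
    Module.finrank_matrix] at h1
  simp only [Fintype.card_fin, Module.finrank_self] at h1
  have h2 : 7 + Module.finrank ℝ (commonKernel F E) = 9 := h1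
  omega

theorem one_mem (hE : IsCoordinatePencil F E Y X) : 1 ∈ commonKernel F E :=
  mem_commonKernel.2 fun j hj => by rw [Matrix.mul_one, hE.trace_eq_zero j hj]

theorem right_mem (hE : IsCoordinatePencil F E Y X) : Y ∈ commonKernel F E :=
  mem_commonKernel.2 hE.trace_mul

theorem eq_sum (hE : IsCoordinatePencil F E Y X) {Φ : Mat₃} (h1 : trace Φ = 0)
    (hY : trace (Φ * Y) = 0) : Φ = ∑ l ∈ E, trace (Φ * X l) • F l := by
  have hK : ∀ A ∈ commonKernel F E, trace (Φ * A) = 0 := by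
    intro A hA
    have hlt := finrank_inf_lt (K := LinearMap.ker (traceFunctional 1)) hE.one_mem (by simp)
    rw [hE.finrank_commonKernel] at hlt
    obtain ⟨c, hc⟩ := exists_eq_smul_of_finrank_le_one (Nat.le_of_lt_succ hlt)
      (x := Y) (y := A - (trace A / 3) • 1) ⟨hE.right_mem, by simp [hE.trace_right]⟩ hE.ne_zero
      ⟨Submodule.sub_mem _ hA (Submodule.smul_mem _ _ hE.one_mem), by simp⟩
    rw [sub_eq_iff_eq_add.1 hc, Matrix.mul_add, trace_add, Matrix.mul_smul, Matrix.mul_smul, trace_smul,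
      trace_smul, hY, Matrix.mul_one, h1, smul_zero, smul_zero, add_zero]
  rw [ext_iff_trace_mul_right]
  intro A
  have hmem : A - ∑ l ∈ E, trace (F l * A) • X l ∈ commonKernel F E := by
    refine mem_commonKernel.2 fun m hm => ?_
    rw [Matrix.mul_sub, trace_sub, Finset.mul_sum, trace_sum, Finset.sum_eq_single_of_mem m hm]
    · rw [Matrix.mul_smul, trace_smul, hE.dual m hm m hm, if_pos rfl, smul_eq_mul, mul_one, sub_self]
    · intro l hl hlm
      rw [Matrix.mul_smul, trace_smul, hE.dual l hl m hm, if_neg hlm.symm, smul_zero]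
  have h := hK _ hmem
  rw [Matrix.mul_sub, trace_sub, sub_eq_zero, Finset.mul_sum, trace_sum] at h
  rw [h, Finset.sum_mul, trace_sum]
  refine Finset.sum_congr rfl fun l _ => ?_
  rw [Matrix.mul_smul, Matrix.smul_mul, trace_smul, trace_smul, smul_eq_mul, smul_eq_mul, mul_comm]

theorem card_filter_eigenvector_le (hE : IsCoordinatePencil F E Y X) {G H : Fin 18 → Mat₃}
    (h : IsTrilinearDecomposition G H F) {w : Fin 3 → ℝ} (hw : w ≠ 0)
    (hY : ∃ c : ℝ, Y *ᵥ w = c • w) {R : Finset (Fin 18)} (hR : R ⊆ E)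
    (hX : ∀ l ∈ R, ∃ c : ℝ, X l *ᵥ w = c • w) : R.card ≤ 3 := by
  by_contra! hc
  obtain ⟨R', hR', hR'c⟩ := Finset.exists_subset_card_eq (Nat.succ_le_of_lt hc)
  have hR'E := hR'.trans hR
  obtain ⟨P, hP⟩ := exists_isProjectionAlong hw
  have hmem : ∀ b, b ⬝ᵥ w = 0 → vecMulVec w b ∈ spanOn F (E \ R') := by
    intro b hb
    rw [hE.eq_sum (Φ := vecMulVec w b) (by rw [trace_vecMulVec, dotProduct_comm, hb]) (by
      obtain ⟨c, hc⟩ := hY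
      rw [trace_vecMulVec_mul, hc, dotProduct_smul, hb, smul_zero])]
    refine Submodule.sum_mem _ fun l hl => ?_
    by_cases hlR : l ∈ R'
    · obtain ⟨c, hc⟩ := hX l (hR' hlR)
      rw [trace_vecMulVec_mul, hc, dotProduct_smul, hb, smul_zero, zero_smul]
      exact Submodule.zero_mem _
    · exact Submodule.smul_mem _ _ (mem_spanOn F (Finset.mem_sdiff.2 ⟨hl, hlR⟩))
  have hcard : (E \ R').card = 3 := by
    rw [Finset.card_sdiff_of_subset hR'E, hE.card_eq, hR'c]
  refine h.false_of_finrank_map_le_one hcard hP ?_ ⟨w, fun hmem' => ?_⟩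
  · set W := spanOn F (E \ R') with hW
    let L : Mat₃ →ₗ[ℝ] Matrix (Fin 2) (Fin 3) ℝ := mulLeftLinearMap (Fin 3) ℝ P
    let D : (Fin 3 → ℝ) →ₗ[ℝ] ℝ := dotProductBilin ℝ ℝ w
    have hrn := LinearMap.finrank_range_add_finrank_ker (L.domRestrict W)
    rw [LinearMap.range_domRestrict] at hrn
    have hWle : Module.finrank ℝ W ≤ 3 := (finrank_spanOn_le F (E \ R')).trans_eq hcard
    have hD := finrank_le_finrank_ker_add D
    rw [Module.finrank_fin_fun, Module.finrank_self] at hD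
    have hb : ∀ b : LinearMap.ker D, (b : Fin 3 → ℝ) ⬝ᵥ w = 0 := fun b => by
      rw [dotProduct_comm]
      exact b.2
    let ψ : LinearMap.ker D →ₗ[ℝ] W :=
      ((vecMulVecBilin ℝ ℝ w).domRestrict (LinearMap.ker D)).codRestrict W fun b => hmem b (hb b)
    have hψ : Function.Injective ψ := by
      rw [← LinearMap.ker_eq_bot, LinearMap.ker_eq_bot']
      intro b hb0
      exact Subtype.ext ((vecMulVec_eq_zero_iff_real.1 (congrArg Subtype.val hb0)).resolve_left hw)
    have h2 := finrank_le_finrank_of_forall_mem ψ hψ (LinearMap.ker (L.domRestrict W)) fun b =>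
      hP.mul_vecMulVec _
    have h3 : Module.finrank ℝ (W.map L) ≤ 1 := by omega
    exact h3
  · obtain ⟨c, hc⟩ := mem_spanOn_iff.1 hmem'
    refine dotProduct_self_ne_zero hw ?_
    rw [← trace_vecMulVec, hc, trace_sum]
    refine Finset.sum_eq_zero fun l hl => ?_
    rw [trace_smul, hE.trace_eq_zero l (Finset.mem_sdiff.1 hl).1, smul_zero]

theorem exists_one_lt_rank (hE : IsCoordinatePencil F E Y X) {G H : Fin 18 → Mat₃}
    (h : IsTrilinearDecomposition F G H) : ∃ l ∈ E, 1 < (Y * X l - X l * Y).rank := by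
  classical
  by_contra! hr
  obtain ⟨t, ht⟩ := exists_det_sub_smul_one_eq_zero Y
  have hM : Y - t • (1 : Mat₃) ≠ 0 := by
    intro h0
    rw [sub_eq_zero] at h0
    have ht0 := hE.trace_right
    rw [h0, trace_smul, trace_one] at ht0
    simp at ht0
    exact hE.ne_zero (by rw [h0, ht0, zero_smul])
  obtain ⟨w, ξ, hw, hξ, ⟨c, hYw⟩, ⟨d, hYξ⟩, hX⟩ := exists_common_eigenvectors_of_det_eq_zero hM ht
  have hX' : ∀ l ∈ E, (∃ c : ℝ, X l *ᵥ w = c • w) ∨ (∃ c : ℝ, ξ ᵥ* X l = c • ξ) := fun l hl =>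
    hX (X l) (by
      refine le_of_eq_of_le (congrArg Matrix.rank ?_) (hr l hl)
      rw [Matrix.sub_mul, Matrix.mul_sub, Matrix.smul_mul, Matrix.mul_smul, Matrix.one_mul, Matrix.mul_one]
      abel)
  have hr1 := hE.card_filter_eigenvector_le h.cyc hw ⟨c + t, by
    rw [add_smul, ← hYw, sub_mulVec, smul_mulVec, one_mulVec, sub_add_cancel]⟩
    (Finset.filter_subset (fun l => ∃ c : ℝ, X l *ᵥ w = c • w) E)
    (fun l hl => (Finset.mem_filter.1 hl).2)
  have hr2 := hE.transpose.card_filter_eigenvector_le h.transpose hξ ⟨d + t, by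
    rw [add_smul, ← hYξ, mulVec_transpose, vecMul_sub, vecMul_smul, vecMul_one, sub_add_cancel]⟩
    (Finset.filter_subset (fun l => ¬ ∃ c : ℝ, X l *ᵥ w = c • w) E)
    (fun l hl => by
      rw [Finset.mem_filter] at hl
      obtain ⟨c, hc⟩ := (hX' l hl.1).resolve_left hl.2
      exact ⟨c, by rw [mulVec_transpose, hc]⟩)
  have := Finset.card_filter_add_card_filter_not (s := E) (fun l => ∃ c : ℝ, X l *ᵥ w = c • w)
  rw [hE.card_eq] at this
  omega

end IsCoordinatePencil

theorem exists_eq_smul_of_cross_eq_zero {u v : Fin 3 → ℝ} (hu : u ≠ 0) (h : u ⨯₃ v = 0) :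
    ∃ c : ℝ, v = c • u := by
  have h1 := cross_cross_eq_smul_sub_smul' u u v
  rw [h, map_zero, eq_comm, sub_eq_zero] at h1
  refine ⟨(u ⬝ᵥ u)⁻¹ * (u ⬝ᵥ v), ?_⟩
  rw [mul_smul, h1, smul_smul, inv_mul_cancel₀ (dotProduct_self_ne_zero hu), one_smul]

/-- A family of vectors of `ℝ³` without two parallel members and without four coplanar ones. -/
structure IsGeneral (J : Finset (Fin 18)) (p : Fin 18 → Fin 3 → ℝ) : Prop where
  cross_ne_zero : ∀ i ∈ J, ∀ j ∈ J, i ≠ j → p i ⨯₃ p j ≠ 0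
  exists_dotProduct_ne_zero : ∀ I ⊆ J, I.card = 4 → ∀ c ≠ 0, ∃ m ∈ I, c ⬝ᵥ p m ≠ 0

namespace IsGeneral

variable {J : Finset (Fin 18)} {p : Fin 18 → Fin 3 → ℝ}

theorem false_of_triple_product_eq_zero (hp : IsGeneral J p) {i j k l : Fin 18}
    (hi : i ∈ J) (hj : j ∈ J) (hk : k ∈ J) (hl : l ∈ J) (hij : i ≠ j) (hik : i ≠ k) (hil : i ≠ l)
    (hjk : j ≠ k) (hjl : j ≠ l) (hkl : k ≠ l) (h1 : p i ⬝ᵥ p j ⨯₃ p k = 0)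
    (h2 : p i ⬝ᵥ p j ⨯₃ p l = 0) : False := by
  obtain ⟨m, hm, hne⟩ := hp.exists_dotProduct_ne_zero {i, j, k, l}
    (by simp [Finset.insert_subset_iff, hi, hj, hk, hl]) (by simp [hij, hik, hil, hjk, hjl, hkl])
    (p i ⨯₃ p j) (hp.cross_ne_zero i hi j hj hij)
  rw [dotProduct_comm] at hne
  simp only [Finset.mem_insert, Finset.mem_singleton] at hm
  rcases hm with rfl | rfl | rfl | rfl
  · exact hne (dot_self_cross _ _)
  · exact hne (dot_cross_self _ _)
  · exact hne (by rw [triple_product_permutation, h1])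
  · exact hne (by rw [triple_product_permutation, h2])

/-- Four members can be split into two planes which avoid a given fifth one. -/
theorem exists_pairing (hp : IsGeneral J p) {m i j k l : Fin 18} (hm : m ∈ J)
    (hi : i ∈ J) (hj : j ∈ J) (hk : k ∈ J) (hl : l ∈ J) (hmi : m ≠ i) (hmj : m ≠ j) (hmk : m ≠ k)
    (hml : m ≠ l) (hij : i ≠ j) (hik : i ≠ k) (hil : i ≠ l)
    (hjk : j ≠ k) (hjl : j ≠ l) (hkl : k ≠ l) :
    (p m ⬝ᵥ p i ⨯₃ p j ≠ 0 ∧ p m ⬝ᵥ p k ⨯₃ p l ≠ 0) ∨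
      (p m ⬝ᵥ p i ⨯₃ p k ≠ 0 ∧ p m ⬝ᵥ p j ⨯₃ p l ≠ 0) := by
  have hswap : ∀ u v : Fin 3 → ℝ, p m ⬝ᵥ u ⨯₃ v = 0 → p m ⬝ᵥ v ⨯₃ u = 0 := fun u v h => by
    rw [← cross_anticomm, dotProduct_neg, h, neg_zero]
  by_contra! hne
  by_cases h1 : p m ⬝ᵥ p i ⨯₃ p j = 0
  · by_cases h2 : p m ⬝ᵥ p i ⨯₃ p k = 0
    · exact hp.false_of_triple_product_eq_zero hm hi hj hk hmi hmj hmk hij hik hjk h1 h2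
    · exact hp.false_of_triple_product_eq_zero hm hj hi hl hmj hmi hml hij.symm hjl hil
        (hswap _ _ h1) (hne.2 h2)
  · by_cases h2 : p m ⬝ᵥ p i ⨯₃ p k = 0
    · exact hp.false_of_triple_product_eq_zero hm hk hi hl hmk hmi hml hik.symm hkl hil
        (hswap _ _ h2) (hne.1 h1)
    · exact hp.false_of_triple_product_eq_zero hm hl hj hk hml hmj hmk hjl.symm hkl.symm hjk
        (hswap _ _ (hne.2 h2)) (hswap _ _ (hne.1 h1))

/-- Among the squares of members of a general family, any five are linearly independent. -/
theorem eq_zero_of_sum_smul_vecMulVec_eq_zero (hp : IsGeneral J p) {I : Finset (Fin 18)}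
    (hI : I ⊆ J) (hc : I.card = 5) {s : Fin 18 → ℝ}
    (hs : ∑ j ∈ I, s j • vecMulVec (p j) (p j) = 0) : ∀ m ∈ I, s m = 0 := by
  intro m hm
  have hform : ∀ u v : Fin 3 → ℝ, ∑ j ∈ I, s j * ((p j ⬝ᵥ u) * (p j ⬝ᵥ v)) = 0 := fun u v => by
    have := congrArg (fun M => u ⬝ᵥ M *ᵥ v) hs
    simp only [sum_mulVec, dotProduct_sum, zero_mulVec, dotProduct_zero] at this
    rw [← this]
    refine Finset.sum_congr rfl fun j _ => ?_
    rw [smul_mulVec, vecMulVec_mulVec, op_smul_eq_smul, dotProduct_smul, dotProduct_smul,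
      dotProduct_comm u, smul_eq_mul, smul_eq_mul, mul_comm (p j ⬝ᵥ v)]
  have hcard : (I.erase m).card = 4 := by rw [Finset.card_erase_of_mem hm, hc]
  obtain ⟨i, j, k, l, hij, hik, hil, hjk, hjl, hkl, he⟩ := Finset.card_eq_four.1 hcard
  have hmem : ∀ x, x ∈ I.erase m ↔ x = i ∨ x = j ∨ x = k ∨ x = l := fun x => by rw [he]; simp
  obtain ⟨hmi, hi⟩ := Finset.mem_erase.1 ((hmem i).2 (by simp))
  obtain ⟨hmj, hj⟩ := Finset.mem_erase.1 ((hmem j).2 (by simp))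
  obtain ⟨hmk, hk⟩ := Finset.mem_erase.1 ((hmem k).2 (by simp))
  obtain ⟨hml, hl⟩ := Finset.mem_erase.1 ((hmem l).2 (by simp))
  have key : ∀ a b c d, (∀ x ∈ I.erase m, x = a ∨ x = b ∨ x = c ∨ x = d) →
      p m ⬝ᵥ p a ⨯₃ p b ≠ 0 ∧ p m ⬝ᵥ p c ⨯₃ p d ≠ 0 → s m = 0 := by
    rintro a b c d hx ⟨h1, h2⟩
    have := hform (p a ⨯₃ p b) (p c ⨯₃ p d)
    rw [Finset.sum_eq_single_of_mem m hm] at this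
    · exact (mul_eq_zero.1 this).resolve_right (mul_ne_zero h1 h2)
    · intro x hxI hxm
      rcases hx x (Finset.mem_erase.2 ⟨hxm, hxI⟩) with rfl | rfl | rfl | rfl
      · rw [dot_self_cross, zero_mul, mul_zero]
      · rw [dot_cross_self, zero_mul, mul_zero]
      · rw [dot_self_cross, mul_zero, mul_zero]
      · rw [dot_cross_self, mul_zero, mul_zero]
  rcases hp.exists_pairing (hI hm) (hI hi) (hI hj) (hI hk) (hI hl) hmi.symm hmj.symm hmk.symm
    hml.symm hij hik hil hjk hjl hkl with h | h
  · exact key _ _ _ _ (fun x hx => (hmem x).1 hx) h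
  · exact key _ _ _ _ (fun x hx => by have := (hmem x).1 hx; tauto) h

theorem card_filter_mem_le_four (hp : IsGeneral J p) (W : Submodule ℝ Mat₃)
    (hW : Module.finrank ℝ W ≤ 4) [DecidablePred fun j => vecMulVec (p j) (p j) ∈ W] :
    (J.filter fun j => vecMulVec (p j) (p j) ∈ W).card ≤ 4 := by
  by_contra! hlt
  obtain ⟨I, hI, hIc⟩ := Finset.exists_subset_card_eq (Nat.succ_le_of_lt hlt)
  let L : (I → ℝ) →ₗ[ℝ] Mat₃ := ∑ i : I, (LinearMap.proj i).smulRight (vecMulVec (p i) (p i))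
  have hL : ∀ c, L c = ∑ i : I, c i • vecMulVec (p i) (p i) := fun c => by
    simp only [L, LinearMap.sum_apply, LinearMap.smulRight_apply, LinearMap.proj_apply]
  have hinj : Function.Injective L := by
    rw [← LinearMap.ker_eq_bot, LinearMap.ker_eq_bot']
    intro c hc
    rw [hL] at hc
    have := hp.eq_zero_of_sum_smul_vecMulVec_eq_zero (hI.trans (Finset.filter_subset _ _)) hIc
      (s := fun i => if hi : i ∈ I then c ⟨i, hi⟩ else 0) (by
        rw [← Finset.sum_coe_sort I, ← hc]
        exact Finset.sum_congr rfl fun i _ => by simp)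
    ext i
    simpa using this i i.2
  have := finrank_le_finrank_of_forall_mem L hinj W fun c => by
    rw [hL]
    exact Submodule.sum_mem _ fun i _ => Submodule.smul_mem _ _ (Finset.mem_filter.1 (hI i.2)).2
  rw [Module.finrank_fintype_fun_eq_card, Fintype.card_coe, hIc] at this
  omega

end IsGeneral

/-- The values of the functional `tr (F j * ·)` on three matrices. -/
noncomputable def coordVec (F : Fin 18 → Mat₃) (A : Fin 3 → Mat₃) (j : Fin 18) : Fin 3 → ℝ :=
  fun k => trace (F j * A k)

/-- The indices whose functional does not vanish on the span of three matrices. -/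
noncomputable def coordSupport (F : Fin 18 → Mat₃) (A : Fin 3 → Mat₃) : Finset (Fin 18) :=
  open Classical in Finset.univ.filter fun j => coordVec F A j ≠ 0

theorem mem_coordSupport {F : Fin 18 → Mat₃} {A : Fin 3 → Mat₃} {j : Fin 18} :
    j ∈ coordSupport F A ↔ coordVec F A j ≠ 0 := by
  simp [coordSupport]

/-- The matrix with rows `n A₀`, `n A₁`, `n A₂`. -/
def rowFrame (n : Fin 3 → ℝ) (A : Fin 3 → Mat₃) : Mat₃ := of fun k => n ᵥ* A k

theorem rowFrame_mulVec_apply (n : Fin 3 → ℝ) (A : Fin 3 → Mat₃) (v : Fin 3 → ℝ) (k : Fin 3) :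
    (rowFrame n A *ᵥ v) k = n ⬝ᵥ A k *ᵥ v := by
  rw [dotProduct_mulVec]
  rfl

namespace IsTrilinearDecomposition

variable {F G H : Fin 18 → Mat₃} {A : Fin 3 → Mat₃}

theorem sum_smul_mul_eq (h : IsTrilinearDecomposition F G H) (c : Fin 3 → ℝ) (B : Mat₃) :
    (∑ k, c k • A k) * B =
      ∑ j ∈ coordSupport F A, ((c ⬝ᵥ coordVec F A j) * trace (G j * B)) • H j := by
  rw [h.mul_eq_sum]
  have hc : ∀ j, trace (F j * ∑ k, c k • A k) = c ⬝ᵥ coordVec F A j := fun j => by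
    rw [Finset.mul_sum, trace_sum]
    exact Finset.sum_congr rfl fun k _ => by rw [Matrix.mul_smul, trace_smul]; rfl
  simp only [hc]
  refine (Finset.sum_subset (Finset.subset_univ _) fun j _ hj => ?_).symm
  rw [mem_coordSupport, not_not] at hj
  rw [hj, dotProduct_zero, zero_mul, zero_smul]

theorem mul_eq_sum_coordVec (h : IsTrilinearDecomposition F G H) (k : Fin 3) (B : Mat₃) :
    A k * B = ∑ j ∈ coordSupport F A, (coordVec F A j k * trace (G j * B)) • H j := by
  have := h.sum_smul_mul_eq (A := A) (Pi.single k 1) B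
  simpa [single_dotProduct, Pi.single_apply, ite_smul] using this

/-- Three matrices `1`, `A 1`, `A 2` with a commutator of rank at least two on which only twelve
functionals live force the `H j` of these functionals into a common rank-one shape. -/
theorem exists_rowFrame_mul_eq (h : IsTrilinearDecomposition F G H) (hA : A 0 = 1)
    (hcard : (coordSupport F A).card ≤ 12) (hC : ¬ (A 1 * A 2 - A 2 * A 1).rank ≤ 1) :
    ∃ n, n ≠ 0 ∧ ∀ j ∈ coordSupport F A, ∃ y,
      rowFrame n A * H j = vecMulVec (coordVec F A j) y := by
  set J := coordSupport F A with hJ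
  let Λ : ((Fin 3 → Mat₃) × (J → ℝ)) →ₗ[ℝ] (J → Fin 3 → ℝ) :=
    LinearMap.pi fun j => LinearMap.pi fun k =>
      (traceFunctional (H j)).comp ((LinearMap.proj k).comp (LinearMap.fst ℝ _ _)) -
        coordVec F A j k • (LinearMap.proj j).comp (LinearMap.snd ℝ _ _)
  have hΛ : ∀ p, Λ p = 0 ↔ ∀ (j : J) (k : Fin 3), trace (p.1 k * H j) = p.2 j * coordVec F A j k := by
    intro p
    rw [funext_iff]
    refine forall_congr' fun j => ?_
    rw [funext_iff]
    refine forall_congr' fun k => ?_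
    change trace (H j * p.1 k) - coordVec F A j k * p.2 j = 0 ↔ _
    rw [sub_eq_zero, trace_mul_comm, mul_comm]
  have hsymm : ∀ p, Λ p = 0 → ∀ k l, p.1 k * A l = p.1 l * A k := by
    have hform : ∀ p, Λ p = 0 → ∀ k l B, trace (p.1 k * A l * B) =
        ∑ j : J, coordVec F A j l * trace (G j * B) * (p.2 j * coordVec F A j k) := by
      intro p hp k l B
      rw [Matrix.mul_assoc, h.mul_eq_sum_coordVec (A := A) l B, Finset.mul_sum, trace_sum,
        ← Finset.sum_coe_sort]
      refine Finset.sum_congr rfl fun j _ => ?_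
      rw [Matrix.mul_smul, trace_smul, (hΛ p).1 hp j k, smul_eq_mul]
    intro p hp k l
    rw [ext_iff_trace_mul_right]
    intro B
    rw [hform p hp k l B, hform p hp l k B]
    exact Finset.sum_congr rfl fun j _ => by ring
  have hk0 : ∀ p, Λ p = 0 → ∀ k, p.1 k = p.1 0 * A k := fun p hp k => by
    rw [← hsymm p hp k 0, hA, Matrix.mul_one]
  have hcomm : ∀ p, Λ p = 0 → p.1 0 * (A 1 * A 2 - A 2 * A 1) = 0 := fun p hp => by
    rw [Matrix.mul_sub, ← Matrix.mul_assoc, ← Matrix.mul_assoc, ← hk0 p hp, ← hk0 p hp,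
      hsymm p hp 1 2, sub_self]
  let κ : LinearMap.ker Λ →ₗ[ℝ] Mat₃ :=
    ((LinearMap.proj 0).comp (LinearMap.fst ℝ (Fin 3 → Mat₃) (J → ℝ))).domRestrict _
  have hκ : ∀ p : LinearMap.ker Λ, κ p = p.1.1 0 := fun p => rfl
  have hinj : Function.Injective κ := by
    rw [← LinearMap.ker_eq_bot, LinearMap.ker_eq_bot']
    intro p hp
    rw [hκ] at hp
    have h1 : ∀ k, p.1.1 k = 0 := fun k => by rw [hk0 p.1 p.2, hp, Matrix.zero_mul]
    refine Subtype.ext (Prod.ext (funext h1) (funext fun j => ?_))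
    have h2 : ∀ k, p.1.2 j * coordVec F A j k = 0 := fun k => by
      rw [← (hΛ p.1).1 p.2 j k, h1, Matrix.zero_mul, trace_zero]
    obtain ⟨k, hk⟩ := Function.ne_iff.1 (mem_coordSupport.1 j.2)
    exact (mul_eq_zero.1 (h2 k)).resolve_right hk
  have h3 : 3 ≤ Module.finrank ℝ (LinearMap.range κ) := by
    have hn := finrank_le_finrank_ker_add Λ
    rw [LinearMap.finrank_range_of_inj hinj]
    simp only [Module.finrank_prod, Module.finrank_pi_fintype, Module.finrank_matrix,
      Module.finrank_self, Fintype.card_fin, Fintype.card_coe, Finset.sum_const, Finset.card_univ,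
      smul_eq_mul] at hn
    omega
  obtain ⟨p, hp⟩ : ∃ p, κ p ≠ 0 := by
    by_contra! h0
    have : LinearMap.range κ = ⊥ := by
      rw [LinearMap.range_eq_bot]
      exact LinearMap.ext h0
    rw [this, finrank_bot] at h3
    omega
  obtain ⟨i, hi⟩ := Function.ne_iff.1 hp
  have hrow : ∀ (q : LinearMap.ker Λ) (r : Fin 3), κ q r ᵥ* (A 1 * A 2 - A 2 * A 1) = 0 :=
    fun q r => congr_fun (hcomm q.1 q.2) r
  set n := κ p i with hn
  have hle : LinearMap.range κ ≤ LinearMap.range ((vecMulVecBilin ℝ ℝ).flip n) := by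
    rintro _ ⟨q, rfl⟩
    choose c hc using fun r => exists_eq_smul_of_vecMul_eq_zero hC hi (hrow p i) (hrow q r)
    refine ⟨c, ?_⟩
    ext r s
    exact (congr_fun (hc r) s).symm
  have heq := Submodule.eq_of_le_of_finrank_le hle (by
    refine le_trans (LinearMap.finrank_range_le _) ?_
    rwa [Module.finrank_fin_fun])
  refine ⟨n, hi, fun j hj => ?_⟩
  have hall : ∀ v : Fin 3 → ℝ, ∃ c : ℝ, ∀ k, n ⬝ᵥ A k *ᵥ (H j *ᵥ v) = coordVec F A j k * c := by
    intro v
    obtain ⟨q, hq⟩ : vecMulVec v n ∈ LinearMap.range κ := heq ▸ ⟨v, rfl⟩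
    refine ⟨q.1.2 ⟨j, hj⟩, fun k => ?_⟩
    rw [mul_comm, ← (hΛ q.1).1 q.2 ⟨j, hj⟩ k, hk0 q.1 q.2, ← hκ, hq, Matrix.mul_assoc,
      trace_vecMulVec_mul, mulVec_mulVec]
  choose y hy using fun i : Fin 3 => hall (Pi.single i 1)
  refine ⟨y, ?_⟩
  ext k i
  rw [vecMulVec_apply, ← hy i k, ← rowFrame_mulVec_apply, mulVec_mulVec, mulVec_single_one]
  rfl

end IsTrilinearDecomposition

/-- `x` and `y` are linearly independent modulo `N`. -/
def IsIndepMod (N : Submodule ℝ Mat₃) (x y : Mat₃) : Prop :=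
  ∀ s t : ℝ, s • x + t • y ∈ N → s = 0 ∧ t = 0

theorem IsIndepMod.symm {N : Submodule ℝ Mat₃} {x y : Mat₃} (h : IsIndepMod N x y) :
    IsIndepMod N y x := fun s t hst => (h t s (by rwa [add_comm])).symm

theorem isIndepMod_of_notMem {N : Submodule ℝ Mat₃} {x y : Mat₃} (hx : x ∉ N)
    (hy : y ∉ N ⊔ ℝ ∙ x) : IsIndepMod N x y := by
  intro s t hst
  have ht : t = 0 := by
    by_contra ht
    refine hy (Submodule.mem_sup.2 ⟨_, N.smul_mem t⁻¹ hst, (-(t⁻¹ * s)) • x,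
      Submodule.smul_mem _ _ (Submodule.mem_span_singleton_self x), ?_⟩)
    rw [smul_add, smul_smul, smul_smul, inv_mul_cancel₀ ht, one_smul, neg_smul]
    abel
  subst ht
  refine ⟨?_, rfl⟩
  by_contra hs
  rw [zero_smul, add_zero] at hst
  exact hx ((N.smul_mem_iff hs).1 hst)

theorem IsIndepMod.of_not_of_notMem {N : Submodule ℝ Mat₃} {x y z : Mat₃} (h : IsIndepMod N x y)
    (hz : z ∉ N) (hzx : ¬ IsIndepMod N z x) : IsIndepMod N z y := by
  by_contra hzy
  have hmem : ∀ w, w ∉ N → ¬ IsIndepMod N z w → ∃ s : ℝ, w + s • z ∈ N := by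
    intro w _ hw
    have := mt (isIndepMod_of_notMem hz) hw
    rw [not_not, Submodule.mem_sup] at this
    obtain ⟨a, ha, b, hb, rfl⟩ := this
    obtain ⟨s, rfl⟩ := Submodule.mem_span_singleton.1 hb
    exact ⟨-s, by simpa using ha⟩
  have hx : x ∉ N := fun hx => one_ne_zero (h 1 0 (by simpa using hx)).1
  have hy : y ∉ N := fun hy => one_ne_zero (h 0 1 (by simpa using hy)).2
  obtain ⟨s, hs⟩ := hmem x hx hzx
  obtain ⟨t, ht⟩ := hmem y hy hzy
  have h0 := h t (-s) (by
    have := N.sub_mem (N.smul_mem t hs) (N.smul_mem s ht)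
    convert this using 1
    rw [smul_add, smul_add, smul_smul, smul_smul, mul_comm s t, neg_smul]
    abel)
  rw [h0.1, zero_smul, add_zero] at ht
  exact hy ht

/-- Among nine squares of members of a general family one can find four such that each is
independent, modulo a three-dimensional space, of at least two of the others. -/
theorem IsGeneral.exists_four {J : Finset (Fin 18)} {p : Fin 18 → Fin 3 → ℝ} (hp : IsGeneral J p)
    (hJ : 9 ≤ J.card) {N : Submodule ℝ Mat₃} (hN : Module.finrank ℝ N ≤ 3) :
    ∃ i ∈ J, ∃ j ∈ J, ∃ k ∈ J, ∃ l ∈ J, i ≠ j ∧ i ≠ k ∧ i ≠ l ∧ j ≠ k ∧ j ≠ l ∧ k ≠ l ∧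
      IsIndepMod N (vecMulVec (p i) (p i)) (vecMulVec (p j) (p j)) ∧
      IsIndepMod N (vecMulVec (p i) (p i)) (vecMulVec (p k) (p k)) ∧
      IsIndepMod N (vecMulVec (p i) (p i)) (vecMulVec (p l) (p l)) ∧
      IsIndepMod N (vecMulVec (p j) (p j)) (vecMulVec (p k) (p k)) ∧
      IsIndepMod N (vecMulVec (p j) (p j)) (vecMulVec (p l) (p l)) := by
  classical
  set τ : Fin 18 → Mat₃ := fun j => vecMulVec (p j) (p j) with hτ
  have hcount : ∀ W : Submodule ℝ Mat₃, Module.finrank ℝ W ≤ 4 →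
      J.card ≤ (J.filter fun j => τ j ∉ W).card + 4 := fun W hW => by
    have h1 : (J.filter fun j => τ j ∈ W).card ≤ 4 := hp.card_filter_mem_le_four W hW
    have h2 := Finset.card_filter_add_card_filter_not (s := J) fun j => τ j ∈ W
    omega
  have hsup : ∀ x : Mat₃, Module.finrank ℝ (N ⊔ ℝ ∙ x : Submodule ℝ Mat₃) ≤ 4 := fun x => by
    have h1 := Submodule.finrank_add_le_finrank_add_finrank N (ℝ ∙ x)
    have h2 := finrank_span_singleton_le x
    omega
  obtain ⟨a, ha⟩ : (J.filter fun j => τ j ∉ N).Nonempty := by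
    have := hcount N (hN.trans (by norm_num))
    exact Finset.card_pos.1 (by omega)
  rw [Finset.mem_filter] at ha
  set Q := J.filter fun j => τ j ∉ N ⊔ ℝ ∙ τ a with hQ
  have hQc : 5 ≤ Q.card := by
    have : J.card ≤ Q.card + 4 := hcount _ (hsup (τ a))
    omega
  have hQJ : ∀ j ∈ Q, j ∈ J := fun j hj => (Finset.mem_filter.1 hj).1
  have hQa : ∀ j ∈ Q, IsIndepMod N (τ a) (τ j) := fun j hj =>
    isIndepMod_of_notMem ha.2 (Finset.mem_filter.1 hj).2
  have hQN : ∀ j ∈ Q, τ j ∉ N := fun j hj hjN =>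
    (Finset.mem_filter.1 hj).2 (Submodule.mem_sup_left hjN)
  have haQ : ∀ j ∈ Q, a ≠ j := by
    rintro j hj rfl
    exact (Finset.mem_filter.1 hj).2
      (Submodule.mem_sup_right (Submodule.mem_span_singleton_self _))
  obtain ⟨b, hb⟩ : Q.Nonempty := Finset.card_pos.1 (by omega)
  obtain ⟨c, hcQ, hbc⟩ : ∃ c ∈ Q, τ c ∉ N ⊔ ℝ ∙ τ b := by
    by_contra! hall
    have h2 : Q.card ≤ (J.filter fun j => τ j ∈ N ⊔ ℝ ∙ τ b).card :=
      Finset.card_le_card fun j hj => Finset.mem_filter.2 ⟨hQJ j hj, hall j hj⟩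
    have h3 : (J.filter fun j => τ j ∈ N ⊔ ℝ ∙ τ b).card ≤ 4 :=
      hp.card_filter_mem_le_four _ (hsup (τ b))
    omega
  have hbc' : b ≠ c := by
    rintro rfl
    exact hbc (Submodule.mem_sup_right (Submodule.mem_span_singleton_self _))
  have hRbc : IsIndepMod N (τ b) (τ c) := isIndepMod_of_notMem (hQN b hb) hbc
  obtain ⟨d, hd⟩ : ((Q.erase b).erase c).Nonempty := by
    refine Finset.card_pos.1 ?_
    rw [Finset.card_erase_of_mem (Finset.mem_erase.2 ⟨hbc'.symm, hcQ⟩),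
      Finset.card_erase_of_mem hb]
    omega
  simp only [Finset.mem_erase] at hd
  obtain ⟨hdc, hdb, hdQ⟩ := hd
  by_cases hdR : IsIndepMod N (τ d) (τ b)
  · exact ⟨a, ha.1, b, hQJ b hb, c, hQJ c hcQ, d, hQJ d hdQ, haQ b hb, haQ c hcQ, haQ d hdQ, hbc',
      hdb.symm, hdc.symm, hQa b hb, hQa c hcQ, hQa d hdQ, hRbc, hdR.symm⟩
  · exact ⟨a, ha.1, c, hQJ c hcQ, b, hQJ b hb, d, hQJ d hdQ, haQ c hcQ, haQ b hb, haQ d hdQ,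
      hbc'.symm, hdc.symm, hdb.symm, hQa c hcQ, hQa b hb, hQa d hdQ, hRbc.symm,
      (hRbc.of_not_of_notMem (hQN d hdQ) hdR).symm⟩

/-- A vanishing combination modulo `N` of four elements, with coefficients `z m (y m · v)`, has no
term whose element is independent of two of the others. -/
theorem IsGeneral.eq_zero_of_isIndepMod {J : Finset (Fin 18)} {y : Fin 18 → Fin 3 → ℝ}
    (hy : IsGeneral J y) {N : Submodule ℝ Mat₃} {τ : Fin 18 → Mat₃} {z : Fin 18 → ℝ}
    {i j k l : Fin 18} (hi : i ∈ J) (hj : j ∈ J) (hk : k ∈ J) (hl : l ∈ J) (hij : i ≠ j)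
    (hik : i ≠ k) (hil : i ≠ l) (hjk : j ≠ k) (hjl : j ≠ l) (hkl : k ≠ l)
    (hN : ∀ v, (z i * (y i ⬝ᵥ v)) • τ i + (z j * (y j ⬝ᵥ v)) • τ j + (z k * (y k ⬝ᵥ v)) • τ k +
      (z l * (y l ⬝ᵥ v)) • τ l ∈ N)
    (h1 : IsIndepMod N (τ i) (τ j)) (h2 : IsIndepMod N (τ i) (τ k)) : z i = 0 := by
  by_contra hz
  have e1 := hN (y l ⨯₃ y k)
  rw [dot_cross_self, dot_self_cross, mul_zero, mul_zero, zero_smul, zero_smul, add_zero,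
    add_zero] at e1
  have e2 := hN (y l ⨯₃ y j)
  rw [dot_cross_self, dot_self_cross, mul_zero, mul_zero, zero_smul, zero_smul, add_zero,
    add_zero] at e2
  exact hy.false_of_triple_product_eq_zero hi hl hj hk hil hij hik hjl.symm hkl.symm hjk
    ((mul_eq_zero.1 (h2 _ _ e2).1).resolve_left hz) ((mul_eq_zero.1 (h1 _ _ e1).1).resolve_left hz)

namespace IsTrilinearDecomposition

variable {F G H : Fin 18 → Mat₃} {A : Fin 3 → Mat₃} {n : Fin 3 → ℝ}

theorem det_rowFrame_ne_zero (h : IsTrilinearDecomposition F G H) (hA : A 0 = 1)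
    (hA0 : ∀ c : Fin 3 → ℝ, ∑ k, c k • A k = 0 → c = 0) (hn : n ≠ 0)
    (hH : ∀ j ∈ coordSupport F A, ∃ y, rowFrame n A * H j = vecMulVec (coordVec F A j) y) :
    (rowFrame n A).det ≠ 0 := by
  intro hdet
  obtain ⟨c, hc0, hc⟩ := exists_vecMul_eq_zero_iff.2 hdet
  obtain ⟨I, hI, hIc⟩ := Finset.exists_subset_card_eq
    ((show 4 ≤ 5 by norm_num).trans (h.five_le_card_filter (fun h0 => hc0 (hA0 c h0))))
  refine h.false_of_four_vecMul_eq_zero hIc hn fun j hj => ?_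
  have hne := (Finset.mem_filter.1 (hI hj)).2
  have hne' : c ⬝ᵥ coordVec F A j ≠ 0 := by
    intro h0
    refine hne ?_
    rw [Finset.mul_sum, trace_sum, ← h0]
    exact Finset.sum_congr rfl fun k _ => by rw [Matrix.mul_smul, trace_smul]; rfl
  obtain ⟨y, hy⟩ := hH j (mem_coordSupport.2 fun h0 => hne' (by rw [h0, dotProduct_zero]))
  have hy0 : y = 0 := by
    have := congrArg (fun M => c ᵥ* M) hy
    simp only [← vecMul_vecMul, hc, zero_vecMul, vecMul_vecMulVec] at this
    exact (smul_eq_zero.1 this.symm).resolve_left hne'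
  rw [hy0, vecMulVec_zero] at hy
  have hrow : (n ᵥ* A 0) ᵥ* H j = 0 := congr_fun hy 0
  rwa [hA, vecMul_one] at hrow

/-- The rank-one matrices `H j`, `j ∈ J`, with columns `R a` and rows `y`, give two general
families. -/
theorem isGeneral_of_mul_eq (h : IsTrilinearDecomposition F G H) {O : Mat₃} (hO : O.det ≠ 0)
    {J : Finset (Fin 18)} (hJ : 9 ≤ J.card) {a y : Fin 18 → Fin 3 → ℝ} (ha : ∀ j ∈ J, a j ≠ 0)
    (hH : ∀ j ∈ J, O * H j = vecMulVec (a j) (y j)) : IsGeneral J a ∧ IsGeneral J y := by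
  have hinv : O⁻¹ * O = 1 := nonsing_inv_mul _ (Ne.isUnit hO)
  have hinv' : O * O⁻¹ = 1 := mul_nonsing_inv _ (Ne.isUnit hO)
  have hH' : ∀ j ∈ J, H j = vecMulVec (O⁻¹ *ᵥ a j) (y j) := fun j hj => by
    rw [← mul_vecMulVec, ← hH j hj, ← Matrix.mul_assoc, hinv, Matrix.one_mul]
  have hne : ∀ j ∈ J, O⁻¹ *ᵥ a j ≠ 0 := fun j hj h0 => ha j hj (by
    rw [← one_mulVec (a j), ← hinv', ← mulVec_mulVec, h0, mulVec_zero])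
  have hy0 : ∀ j ∈ J, y j ≠ 0 := by
    intro j hj h0
    obtain ⟨i, hi, hij⟩ := Finset.exists_mem_ne (show 1 < J.card by omega) j
    exact h.false_of_two_same_column (hne i hi) hij (hH' i hi) (y := 0) (by
      rw [hH' j hj, h0, vecMulVec_zero, vecMulVec_zero])
  refine ⟨⟨fun i hi j hj hij h0 => ?_, fun I hI hIc c hc => ?_⟩,
    fun i hi j hj hij h0 => ?_, fun I hI hIc c hc => ?_⟩
  · obtain ⟨t, ht⟩ := exists_eq_smul_of_cross_eq_zero (ha i hi) h0
    refine h.false_of_two_same_column (hne i hi) hij (hH' i hi) (y := t • y j) ?_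
    rw [hH' j hj, ht, mulVec_smul, smul_vecMulVec, vecMulVec_smul]
  · by_contra! hall
    refine h.false_of_four_vecMul_eq_zero hIc (u := c ᵥ* O) (fun h0 => hc ?_) fun j hj => ?_
    · rw [← vecMul_one c, ← hinv', ← vecMul_vecMul, h0, zero_vecMul]
    · rw [vecMul_vecMul, hH j (hI hj), vecMul_vecMulVec, hall j hj, zero_smul]
  · obtain ⟨t, ht⟩ := exists_eq_smul_of_cross_eq_zero (hy0 i hi) h0
    refine h.false_of_two_same_row (hy0 i hi) hij (hH' i hi) (y := t • (O⁻¹ *ᵥ a j)) ?_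
    rw [hH' j hj, ht, smul_vecMulVec, vecMulVec_smul]
  · by_contra! hall
    refine h.false_of_four_mulVec_eq_zero hIc hc fun j hj => ?_
    rw [hH' j (hI hj), vecMulVec_mulVec, dotProduct_comm, hall j hj]
    simp

/-- The matrix with columns `O * A k * b`, as a function of `b`. -/
noncomputable def columnMap (O : Mat₃) (A : Fin 3 → Mat₃) : (Fin 3 → ℝ) →ₗ[ℝ] Mat₃ :=
  LinearMap.pi fun i => LinearMap.pi fun k => (LinearMap.proj i).comp (O * A k).mulVecLin

theorem columnMap_apply (O : Mat₃) (A : Fin 3 → Mat₃) (b : Fin 3 → ℝ) (i k : Fin 3) :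
    columnMap O A b i k = ((O * A k) *ᵥ b) i := rfl

theorem columnMap_mulVec (h : IsTrilinearDecomposition F G H) {O : Mat₃}
    {y : Fin 18 → Fin 3 → ℝ}
    (hH : ∀ j ∈ coordSupport F A, O * H j = vecMulVec (coordVec F A j) (y j)) (B : Mat₃)
    (v : Fin 3 → ℝ) : columnMap O A (B *ᵥ v) = ∑ j ∈ coordSupport F A,
      (trace (G j * B) * (y j ⬝ᵥ v)) • vecMulVec (coordVec F A j) (coordVec F A j) := by
  ext i k
  rw [columnMap_apply, mulVec_mulVec, Matrix.mul_assoc, h.mul_eq_sum_coordVec (A := A) k B,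
    Finset.mul_sum, sum_mulVec, Finset.sum_apply, Matrix.sum_apply]
  refine Finset.sum_congr rfl fun j hj => ?_
  rw [Matrix.mul_smul, hH j hj, smul_mulVec, vecMulVec_mulVec]
  simp [vecMulVec_apply]
  ring

theorem rank_commutator_le_one (h : IsTrilinearDecomposition F G H) (hA : A 0 = 1)
    (hA0 : ∀ c : Fin 3 → ℝ, ∑ k, c k • A k = 0 → c = 0)
    (hcard : (coordSupport F A).card ≤ 12) : (A 1 * A 2 - A 2 * A 1).rank ≤ 1 := by
  classical
  by_contra hC
  obtain ⟨n, hn, hH⟩ := h.exists_rowFrame_mul_eq hA hcard hC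
  have hdet := h.det_rowFrame_ne_zero hA hA0 hn hH
  have hH' : ∀ j, ∃ y, j ∈ coordSupport F A →
      rowFrame n A * H j = vecMulVec (coordVec F A j) y := fun j => by
    by_cases hj : j ∈ coordSupport F A
    · obtain ⟨y, hy⟩ := hH j hj
      exact ⟨y, fun _ => hy⟩
    · exact ⟨0, fun hj' => (hj hj').elim⟩
  choose y hy using hH'
  set J := coordSupport F A with hJ
  have hB0 : ∀ B, (∀ j ∈ J, trace (G j * B) = 0) → B = 0 := fun B hB => by
    rw [← Matrix.one_mul B, ← hA, h.mul_eq_sum_coordVec]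
    exact Finset.sum_eq_zero fun j hj => by rw [hB j hj, mul_zero, zero_smul]
  have h9 : Module.finrank ℝ Mat₃ = 9 := by simp [Module.finrank_matrix]
  have hJ9 : 9 ≤ J.card := by
    by_contra! hlt
    obtain ⟨B, hB, hz⟩ := exists_ne_zero_forall_eq_zero (fun j => traceFunctional (G j)) J
      (by rwa [h9])
    exact hB (hB0 B hz)
  obtain ⟨ha, hy'⟩ := h.isGeneral_of_mul_eq hdet hJ9 (fun j hj => mem_coordSupport.1 hj) hy
  set N := LinearMap.range (columnMap (rowFrame n A) A) with hN
  have hN3 : Module.finrank ℝ N ≤ 3 :=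
    (LinearMap.finrank_range_le _).trans_eq (Module.finrank_fin_fun ℝ)
  obtain ⟨i, hi, j, hj, k, hk, l, hl, hij, hik, hil, hjk, hjl, hkl, rij, rik, ril, rjk, rjl⟩ :=
    ha.exists_four hJ9 hN3
  have hI : ({i, j, k, l} : Finset (Fin 18)) ⊆ J := by
    simp [Finset.insert_subset_iff, hi, hj, hk, hl]
  obtain ⟨B, hB, hz⟩ := exists_ne_zero_forall_eq_zero (fun j => traceFunctional (G j))
    (J \ {i, j, k, l}) (by
      rw [h9, Finset.card_sdiff_of_subset hI, Finset.card_insert_of_notMem (by simp [*]),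
        Finset.card_insert_of_notMem (by simp [*]), Finset.card_pair hkl]
      omega)
  have hmem : ∀ v, ∑ m ∈ {i, j, k, l}, (trace (G m * B) * (y m ⬝ᵥ v)) •
      vecMulVec (coordVec F A m) (coordVec F A m) ∈ N := by
    intro v
    refine ⟨B *ᵥ v, ?_⟩
    rw [h.columnMap_mulVec hy]
    refine (Finset.sum_subset hI fun m hmJ hm => ?_).symm
    rw [show trace (G m * B) = 0 from hz m (Finset.mem_sdiff.2 ⟨hmJ, hm⟩), zero_mul, zero_smul]
  set z : Fin 18 → ℝ := fun m => trace (G m * B) with hzdef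
  set τ : Fin 18 → Mat₃ := fun m => vecMulVec (coordVec F A m) (coordVec F A m) with hτ
  have hmem' : ∀ v, (z i * (y i ⬝ᵥ v)) • τ i + ((z j * (y j ⬝ᵥ v)) • τ j +
      ((z k * (y k ⬝ᵥ v)) • τ k + (z l * (y l ⬝ᵥ v)) • τ l)) ∈ N := fun v => by
    have := hmem v
    rwa [Finset.sum_insert (by simp [*]), Finset.sum_insert (by simp [*]),
      Finset.sum_pair hkl] at this
  have zi : z i = 0 := hy'.eq_zero_of_isIndepMod (τ := τ) (z := z) hi hj hk hl hij hik hil hjk hjl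
    hkl (fun v => by convert hmem' v using 1; abel) rij rik
  have zj : z j = 0 := hy'.eq_zero_of_isIndepMod (τ := τ) (z := z) hj hi hk hl hij.symm hjk hjl hik
    hil hkl (fun v => by convert hmem' v using 1; abel) rij.symm rjk
  have zk : z k = 0 := hy'.eq_zero_of_isIndepMod (τ := τ) (z := z) hk hi hj hl hik.symm hjk.symm
    hkl hij hil hjl (fun v => by convert hmem' v using 1; abel) rik.symm rjk.symm
  have zl : z l = 0 := hy'.eq_zero_of_isIndepMod (τ := τ) (z := z) hl hi hj hk hil.symm hjl.symm
    hkl.symm hij hik hjk (fun v => by convert hmem' v using 1; abel) ril.symm rjl.symm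
  refine hB (hB0 B fun m hm => ?_)
  by_cases hmI : m ∈ ({i, j, k, l} : Finset (Fin 18))
  · simp only [Finset.mem_insert, Finset.mem_singleton] at hmI
    rcases hmI with rfl | rfl | rfl | rfl
    exacts [zi, zj, zk, zl]
  · exact hz m (Finset.mem_sdiff.2 ⟨hm, hmI⟩)

end IsTrilinearDecomposition

theorem IsCoordinatePencil.rank_commutator_le_one {F : Fin 18 → Mat₃} {E : Finset (Fin 18)}
    {Y : Mat₃} {X : Fin 18 → Mat₃} (hE : IsCoordinatePencil F E Y X) {G H : Fin 18 → Mat₃}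
    (h : IsTrilinearDecomposition F G H) {l : Fin 18} (hl : l ∈ E) :
    (Y * X l - X l * Y).rank ≤ 1 := by
  refine h.rank_commutator_le_one (A := ![1, Y, X l]) rfl (fun c hc => ?_) ?_
  · rw [Fin.sum_univ_three] at hc
    simp only [cons_val] at hc
    have h2 : c 2 = 0 := by
      have := congrArg (fun M => trace (F l * M)) hc
      simpa [Matrix.mul_add, hE.trace_eq_zero l hl, hE.trace_mul l hl, hE.dual l hl l hl] using this
    have h0 : c 0 = 0 := by
      have := congrArg trace hc
      simpa [h2, hE.trace_right] using this
    have h1 : c 1 = 0 := by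
      rw [h0, h2, zero_smul, zero_smul, zero_add, add_zero] at hc
      exact (smul_eq_zero.1 hc).resolve_right hE.ne_zero
    ext k
    fin_cases k <;> assumption
  · have hsub : coordSupport F ![1, Y, X l] ⊆ (E.erase l)ᶜ := by
      intro m hm
      rw [Finset.mem_compl]
      intro hmE
      obtain ⟨hml, hmE⟩ := Finset.mem_erase.1 hmE
      refine mem_coordSupport.1 hm (funext fun k => ?_)
      fin_cases k
      · simp [coordVec, hE.trace_eq_zero m hmE]
      · simp [coordVec, hE.trace_mul m hmE]
      · simp [coordVec, hE.dual l hl m hmE, hml]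
    have := Finset.card_le_card hsub
    rwa [Finset.card_compl, Finset.card_erase_of_mem hl, hE.card_eq, Fintype.card_fin] at this

theorem not_isTrilinearDecomposition (F G H : Fin 18 → Mat₃) :
    ¬ IsTrilinearDecomposition F G H := by
  intro h
  obtain ⟨F', G', H', E, Y, X, h', hE⟩ := h.exists_isCoordinatePencil
  obtain ⟨l, hl, hr⟩ := hE.exists_one_lt_rank h'
  exact hr.not_ge (hE.rank_commutator_le_one h' hl)

theorem exists_forall_eq_trace_mul (f : Mat₃ →ₗ[ℝ] ℝ) : ∃ X : Mat₃, ∀ A, f A = trace (X * A) := by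
  refine ⟨of fun i k => f (single k i 1), fun A => ?_⟩
  have : f = traceFunctional (of fun i k => f (single k i 1)) := by
    refine Matrix.ext_linearMap _ fun i j => LinearMap.ext_ring ?_
    simp [trace_mul_single]
  exact LinearMap.congr_fun this A

/-- Bläser: there is no exact rank-18 bilinear algorithm for 3×3 matrix
multiplication; the 3×3 matrix multiplication tensor has rank at least 19. -/
theorem blaser_no_rank_eighteen :
    ¬ ∃ (f g : Fin 18 → (Matrix (Fin 3) (Fin 3) ℝ) →ₗ[ℝ] ℝ)
        (H : Fin 18 → Matrix (Fin 3) (Fin 3) ℝ),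
        ∀ A B : Matrix (Fin 3) (Fin 3) ℝ,
          A * B = ∑ j, (f j A * g j B) • H j := by
  rintro ⟨f, g, H, h⟩
  choose F hF using fun j => exists_forall_eq_trace_mul (f j)
  choose G hG using fun j => exists_forall_eq_trace_mul (g j)
  refine not_isTrilinearDecomposition F G H fun A B C => ?_
  rw [h A B, Finset.sum_mul, trace_sum]
  exact Finset.sum_congr rfl fun j _ => by
    rw [Matrix.smul_mul, trace_smul, smul_eq_mul, hF, hG]
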